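/- Let a_1, ..., a_7 and b_1, ..., b_7 be integers with a_i ≥ 1 for each i, such that the product of all a_i times the product over 1 ≤ t < s ≤ 7 of (a_t·b_s - a_s·b_t) is nonzero, and such that ∏_{i=1}^{7}(a_i·n + b_i) has no fixed prime divisor (for every prime p there exists a positive integer n with p not dividing ∏_{i=1}^{7}(a_i·n + b_i)). Then there exist δ > 0 and x_0 such that for all x ≥ x_0, the number of positive integers n ≤ x for which ∏_{i=1}^{7}(a_i·n + b_i) is positive, has at most 27 prime factors counted with multiplicity, and moreover each individual factor a_i·n + b_i is squarefree, is at least δ·x/(log x)^7. -/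

import Mathlib

/-- The weight `log p / p` on the primes. -/
noncomputable def primeLogWeight (n : ℕ) : ℝ := if n.Prime then Real.log n / n else 0

theorem primeLogWeight_nonneg (n : ℕ) : 0 ≤ primeLogWeight n := by
  unfold primeLogWeight
  split_ifs
  · positivity
  · exact le_rfl

theorem log_factorial_eq_sum_primes (n : ℕ) :
    Real.log (n.factorial) =
      ∑ p ∈ (Finset.Icc 0 n).filter Nat.Prime, (n.factorial.factorization p : ℝ) * Real.log p := by
  have h := Nat.prod_factorization_pow_eq_self (Nat.factorial_ne_zero n)
  have h2 : n.factorial.factorization.support ⊆ (Finset.Icc 0 n).filter Nat.Prime := by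
    intro p hp
    have hp' : p ∈ n.factorial.primeFactors := by simpa using hp
    have := Nat.prime_of_mem_primeFactors hp'
    simp only [Finset.mem_filter, Finset.mem_Icc, zero_le, true_and]
    exact ⟨(this.dvd_factorial).1 (Nat.dvd_of_mem_primeFactors hp'), this⟩
  rw [Finsupp.prod_of_support_subset _ h2 _ (by simp)] at h
  conv_lhs => rw [← h]
  push_cast
  rw [Real.log_prod]
  · simp
  · intro p hp
    have := (Finset.mem_filter.1 hp).2.pos
    positivity

theorem div_le_factorization_factorial {n p : ℕ} (hp : p.Prime) :
    (n : ℝ) / p - 1 ≤ n.factorial.factorization p := by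
  have h1 : n / p ≤ n.factorial.factorization p := by
    rw [Nat.factorization_factorial hp (b := Nat.log p n + 2) (by omega)]
    have := Finset.single_le_sum (f := fun i => n / p ^ i) (fun i _ => Nat.zero_le _)
      (Finset.mem_Ico.2 ⟨le_refl 1, by omega⟩ : 1 ∈ Finset.Ico 1 (Nat.log p n + 2))
    simpa using this
  have h3 : (n : ℝ) / p < (n / p : ℕ) + 1 := by
    rw [div_lt_iff₀ (by exact_mod_cast hp.pos)]
    exact_mod_cast (by rw [mul_comm]; exact Nat.lt_mul_div_succ n hp.pos)
  have : ((n / p : ℕ) : ℝ) ≤ n.factorial.factorization p := by exact_mod_cast h1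
  linarith

theorem factorization_factorial_le_div {n p : ℕ} (hp : p.Prime) :
    (n.factorial.factorization p : ℝ) ≤ n / (p - 1) := by
  have hp1 : (0 : ℝ) < (p : ℝ) - 1 := by
    have : (1 : ℝ) < p := by exact_mod_cast hp.one_lt
    linarith
  rcases Nat.eq_zero_or_pos n with rfl | hn
  · simp
  have := Fact.mk hp
  have h := (sub_one_mul_padicValNat_factorial_lt_of_ne_zero p hn.ne').le
  rw [← Nat.factorization_def _ hp] at h
  rw [le_div_iff₀ hp1, mul_comm]
  have h' : (((p - 1) * n.factorial.factorization p : ℕ) : ℝ) ≤ n := by exact_mod_cast h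
  rwa [Nat.cast_mul, Nat.cast_pred hp.pos] at h'

theorem sum_primeLogWeight_eq (n : ℕ) :
    ∑ k ∈ Finset.Icc 0 n, primeLogWeight k =
      ∑ p ∈ (Finset.Icc 0 n).filter Nat.Prime, Real.log p / p := by
  simp only [primeLogWeight, Finset.sum_filter]

theorem sum_primeLogWeight_le {n : ℕ} (hn : 0 < n) :
    ∑ k ∈ Finset.Icc 0 n, primeLogWeight k ≤ Real.log n + Real.log 4 := by
  have hn' : (0 : ℝ) < n := by exact_mod_cast hn
  have h1 : ∑ p ∈ (Finset.Icc 0 n).filter Nat.Prime, ((n : ℝ) / p - 1) * Real.log p ≤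
      Real.log n.factorial := by
    rw [log_factorial_eq_sum_primes]
    refine Finset.sum_le_sum fun p hp => ?_
    have hp := (Finset.mem_filter.1 hp).2
    exact mul_le_mul_of_nonneg_right (div_le_factorization_factorial hp) (Real.log_natCast_nonneg p)
  have h2 : Real.log n.factorial ≤ n * Real.log n := by
    rw [← Real.log_pow]
    exact Real.log_le_log (by exact_mod_cast n.factorial_pos)
      (by exact_mod_cast Nat.factorial_le_pow n)
  have h3 := Chebyshev.theta_le_log4_mul_x (x := n) hn'.le
  rw [Chebyshev.theta_eq_sum_Icc, Nat.floor_natCast] at h3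
  have h4 : ∑ p ∈ (Finset.Icc 0 n).filter Nat.Prime, ((n : ℝ) / p - 1) * Real.log p =
      n * ∑ k ∈ Finset.Icc 0 n, primeLogWeight k -
        ∑ p ∈ (Finset.Icc 0 n).filter Nat.Prime, Real.log p := by
    rw [sum_primeLogWeight_eq, Finset.mul_sum, ← Finset.sum_sub_distrib]
    exact Finset.sum_congr rfl fun p _ => by ring
  have h5 : n * ∑ k ∈ Finset.Icc 0 n, primeLogWeight k ≤ n * (Real.log n + Real.log 4) := by
    linarith
  exact le_of_mul_le_mul_left h5 hn'

theorem summable_log_div_sq : Summable fun n : ℕ => Real.log n / (n : ℝ) ^ 2 := by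
  have h : Summable fun n : ℕ => 2 * (1 / (n : ℝ) ^ (3 / 2 : ℝ)) :=
    (Real.summable_one_div_nat_rpow.2 (by norm_num)).mul_left 2
  refine Summable.of_nonneg_of_le (fun n => by positivity) (fun n => ?_) h
  rcases Nat.eq_zero_or_pos n with rfl | hn
  · simp
  have hn' : (0 : ℝ) < n := by exact_mod_cast hn
  have h1 : Real.log n ≤ (n : ℝ) ^ (1 / 2 : ℝ) / (1 / 2) :=
    Real.log_le_rpow_div hn'.le (by norm_num)
  have h2 : (n : ℝ) ^ (2 : ℕ) = (n : ℝ) ^ (3 / 2 : ℝ) * (n : ℝ) ^ (1 / 2 : ℝ) := by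
    rw [← Real.rpow_add hn', ← Real.rpow_natCast]
    norm_num
  rw [h2, div_le_iff₀ (by positivity)]
  have h3 : (0 : ℝ) < (n : ℝ) ^ (3 / 2 : ℝ) := by positivity
  calc Real.log n ≤ (n : ℝ) ^ (1 / 2 : ℝ) / (1 / 2) := h1
    _ = _ := by field_simp

theorem exists_sum_log_div_sq_le :
    ∃ C : ℝ, 0 ≤ C ∧ ∀ s : Finset ℕ, ∑ n ∈ s, Real.log n / (n : ℝ) ^ 2 ≤ C :=
  ⟨_, tsum_nonneg fun n => by positivity,
    fun s => summable_log_div_sq.sum_le_tsum s fun n _ => by positivity⟩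

theorem exists_le_sum_primeLogWeight :
    ∃ C : ℝ, 0 ≤ C ∧ ∀ n : ℕ, 0 < n →
      Real.log n - C ≤ ∑ k ∈ Finset.Icc 0 n, primeLogWeight k := by
  obtain ⟨C, hC, hs⟩ := exists_sum_log_div_sq_le
  refine ⟨2 * C + 1, by positivity, fun n hn => ?_⟩
  have hn' : (0 : ℝ) < n := by exact_mod_cast hn
  have h1 : Real.log n.factorial ≤
      ∑ p ∈ (Finset.Icc 0 n).filter Nat.Prime,
        n * (Real.log p / p + 2 * (Real.log p / (p : ℝ) ^ 2)) := by
    rw [log_factorial_eq_sum_primes]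
    refine Finset.sum_le_sum fun p hp => ?_
    have hp := (Finset.mem_filter.1 hp).2
    have hp2 : (2 : ℝ) ≤ p := by exact_mod_cast hp.two_le
    have hl := Real.log_natCast_nonneg p
    calc (n.factorial.factorization p : ℝ) * Real.log p
        ≤ n / (p - 1) * Real.log p :=
          mul_le_mul_of_nonneg_right (factorization_factorial_le_div hp) hl
      _ = n * Real.log p * (1 / (p - 1)) := by ring
      _ ≤ n * Real.log p * (1 / p + 2 / (p : ℝ) ^ 2) := by
          refine mul_le_mul_of_nonneg_left ?_ (by positivity)
          rw [div_add_div _ _ (by positivity) (by positivity),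
            div_le_div_iff₀ (by linarith) (by positivity)]
          nlinarith [mul_nonneg (by linarith : (0 : ℝ) ≤ p) (by linarith : (0 : ℝ) ≤ p - 2)]
      _ = _ := by ring
  have h2 : n * Real.log n - n ≤ Real.log n.factorial := by
    have := Stirling.le_log_factorial_stirling hn.ne'
    have h3 := Real.log_natCast_nonneg n
    have h4 : 0 ≤ Real.log (2 * Real.pi) := Real.log_nonneg (by nlinarith [Real.pi_gt_three])
    linarith
  rw [← Finset.mul_sum, Finset.sum_add_distrib, ← Finset.mul_sum, ← sum_primeLogWeight_eq] at h1
  have h5 := hs ((Finset.Icc 0 n).filter Nat.Prime)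
  have h6 : n * (Real.log n - 1) ≤ n * (∑ k ∈ Finset.Icc 0 n, primeLogWeight k +
      2 * ∑ p ∈ (Finset.Icc 0 n).filter Nat.Prime, Real.log p / (p : ℝ) ^ 2) := by linarith
  have h7 := le_of_mul_le_mul_left h6 hn'
  linarith

/-- **First theorem of Mertens**: the weighted sum over primes is the logarithm up to a constant. -/
theorem exists_abs_sum_primeLogWeight_sub_log_le :
    ∃ C : ℝ, 0 < C ∧ ∀ x : ℝ, 1 ≤ x →
      |∑ k ∈ Finset.Icc 0 ⌊x⌋₊, primeLogWeight k - Real.log x| ≤ C := by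
  obtain ⟨C, hC, hl⟩ := exists_le_sum_primeLogWeight
  have h4 : 0 < Real.log 4 := Real.log_pos (by norm_num)
  have h2 : 0 < Real.log 2 := Real.log_pos (by norm_num)
  refine ⟨C + Real.log 4 + Real.log 2, by linarith, fun x hx => ?_⟩
  have hn : 0 < ⌊x⌋₊ := Nat.floor_pos.2 hx
  have hn' : (1 : ℝ) ≤ ⌊x⌋₊ := by exact_mod_cast hn
  have hx1 : Real.log ⌊x⌋₊ ≤ Real.log x :=
    Real.log_le_log (by linarith) (Nat.floor_le (by linarith))
  have hx2 : Real.log x ≤ Real.log ⌊x⌋₊ + Real.log 2 := by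
    rw [← Real.log_mul (by linarith) (by norm_num)]
    exact Real.log_le_log (by linarith) (by linarith [Nat.lt_floor_add_one x])
  have h5 := hl _ hn
  have h6 := sum_primeLogWeight_le hn
  rw [abs_le]
  constructor <;> linarith

theorem integral_inv_mul_log_add {c z : ℝ} (hz : 1 ≤ z) :
    IntervalIntegrable (fun t => t⁻¹ * (Real.log t + c)) MeasureTheory.volume 1 z ∧
    ∫ t in (1 : ℝ)..z, t⁻¹ * (Real.log t + c) = Real.log z ^ 2 / 2 + c * Real.log z := by
  have hpos : ∀ t ∈ Set.uIcc 1 z, 0 < t := fun t ht => by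
    rw [Set.uIcc_of_le hz] at ht
    linarith [ht.1]
  have hint : IntervalIntegrable (fun t => t⁻¹ * (Real.log t + c)) MeasureTheory.volume 1 z := by
    refine ContinuousOn.intervalIntegrable fun t ht => ContinuousAt.continuousWithinAt ?_
    have := (hpos t ht).ne'
    fun_prop (disch := assumption)
  refine ⟨hint, ?_⟩
  rw [intervalIntegral.integral_eq_sub_of_hasDerivAt
    (f := fun t => Real.log t ^ 2 / 2 + c * Real.log t) (fun t ht => ?_) hint]
  · simp
  · have h := Real.hasDerivAt_log (hpos t ht).ne'
    exact (((h.pow 2).div_const 2).add (h.const_mul c)).congr_deriv (by push_cast; ring)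

theorem integral_deriv_inv_log_mul {c z y : ℝ} (hz : 1 < z) (hy : z ≤ y) :
    IntervalIntegrable (fun t => -t⁻¹ / Real.log t ^ 2) MeasureTheory.volume z y ∧
    IntervalIntegrable (fun t => -t⁻¹ / Real.log t ^ 2 * (Real.log t + c))
      MeasureTheory.volume z y ∧
    ∫ t in z..y, -t⁻¹ / Real.log t ^ 2 * (Real.log t + c) =
      Real.log (Real.log z) - Real.log (Real.log y) + c / Real.log y - c / Real.log z := by
  have hpos : ∀ t ∈ Set.uIcc z y, 1 < t := fun t ht => by
    rw [Set.uIcc_of_le hy] at ht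
    linarith [ht.1]
  have hint0 : IntervalIntegrable (fun t => -t⁻¹ / Real.log t ^ 2) MeasureTheory.volume z y := by
    refine ContinuousOn.intervalIntegrable fun t ht => ContinuousAt.continuousWithinAt ?_
    have h1 : t ≠ 0 := (zero_lt_one.trans (hpos t ht)).ne'
    have h2 : Real.log t ^ 2 ≠ 0 := pow_ne_zero _ (Real.log_pos (hpos t ht)).ne'
    fun_prop (disch := assumption)
  have hint : IntervalIntegrable (fun t => -t⁻¹ / Real.log t ^ 2 * (Real.log t + c))
      MeasureTheory.volume z y := by
    refine ContinuousOn.intervalIntegrable fun t ht => ContinuousAt.continuousWithinAt ?_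
    have h1 : t ≠ 0 := (zero_lt_one.trans (hpos t ht)).ne'
    have h2 : Real.log t ^ 2 ≠ 0 := pow_ne_zero _ (Real.log_pos (hpos t ht)).ne'
    fun_prop (disch := assumption)
  refine ⟨hint0, hint, ?_⟩
  rw [intervalIntegral.integral_eq_sub_of_hasDerivAt
    (f := fun t => -Real.log (Real.log t) + c * (Real.log t)⁻¹) (fun t ht => ?_) hint]
  · rw [div_eq_mul_inv, div_eq_mul_inv]
    ring
  · have h1 : t ≠ 0 := (zero_lt_one.trans (hpos t ht)).ne'
    have h2 : Real.log t ≠ 0 := (Real.log_pos (hpos t ht)).ne'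
    have h := Real.hasDerivAt_log h1
    refine (((h.log h2).neg).add ((h.inv h2).const_mul c)).congr_deriv ?_
    field_simp
    ring

theorem abs_sum_log_mul_primeLogWeight_sub_le {C : ℝ} (hC : ∀ x : ℝ, 1 ≤ x →
      |∑ k ∈ Finset.Icc 0 ⌊x⌋₊, primeLogWeight k - Real.log x| ≤ C)
    {z : ℝ} (hz : 1 ≤ z) :
    |∑ k ∈ Finset.Icc 0 ⌊z⌋₊, Real.log k * primeLogWeight k - Real.log z ^ 2 / 2| ≤
      2 * C * Real.log z := by
  have hpos : ∀ t ∈ Set.Icc 1 z, t ≠ 0 := fun t ht => by linarith [ht.1]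
  have hderiv : ∀ t ∈ Set.Icc 1 z, deriv Real.log t = t⁻¹ := fun t _ => Real.deriv_log t
  have hint : MeasureTheory.IntegrableOn (deriv Real.log) (Set.Icc 1 z) := by
    rw [Real.deriv_log']
    refine ContinuousOn.integrableOn_Icc fun t ht => ContinuousAt.continuousWithinAt ?_
    exact continuousAt_inv₀ (hpos t ht)
  have h := sum_mul_eq_sub_integral_mul₀ primeLogWeight (by simp [primeLogWeight]) z
    (fun t ht => Real.differentiableAt_log (hpos t ht)) hint
  rw [h, Real.deriv_log', ← intervalIntegral.integral_of_le hz]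
  have hi : IntervalIntegrable (fun t : ℝ => t⁻¹ * ∑ k ∈ Finset.Icc 0 ⌊t⌋₊, primeLogWeight k)
      MeasureTheory.volume 1 z := by
    rw [intervalIntegrable_iff_integrableOn_Icc_of_le hz]
    rw [Real.deriv_log'] at hint
    exact integrableOn_mul_sum_Icc primeLogWeight (m := 0) zero_le_one hint
  obtain ⟨i1, e1⟩ := integral_inv_mul_log_add (c := C) hz
  obtain ⟨i2, e2⟩ := integral_inv_mul_log_add (c := -C) hz
  have b1 := intervalIntegral.integral_mono_on hz hi i1 fun t ht => by
    have := abs_le.1 (hC t ht.1)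
    have h0 : 0 ≤ t⁻¹ := inv_nonneg.2 (by linarith [ht.1])
    exact mul_le_mul_of_nonneg_left (by linarith) h0
  have b2 := intervalIntegral.integral_mono_on hz i2 hi fun t ht => by
    have := abs_le.1 (hC t ht.1)
    have h0 : 0 ≤ t⁻¹ := inv_nonneg.2 (by linarith [ht.1])
    exact mul_le_mul_of_nonneg_left (by linarith) h0
  rw [e1] at b1
  rw [e2] at b2
  have hA := abs_le.1 (hC z hz)
  have hl := Real.log_nonneg hz
  rw [abs_le]
  constructor <;> nlinarith

theorem sum_inv_log_mul_primeLogWeight_le {C : ℝ} (hC : ∀ x : ℝ, 1 ≤ x →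
      |∑ k ∈ Finset.Icc 0 ⌊x⌋₊, primeLogWeight k - Real.log x| ≤ C)
    {z y : ℝ} (hz : 1 < z) (hy : z ≤ y) :
    ∑ k ∈ Finset.Ioc ⌊z⌋₊ ⌊y⌋₊, (Real.log k)⁻¹ * primeLogWeight k ≤
      Real.log (Real.log y / Real.log z) + 2 * C / Real.log z := by
  have hpos : ∀ t ∈ Set.Icc z y, 1 < t := fun t ht => by linarith [ht.1]
  have hd : ∀ t ∈ Set.Icc z y,
      HasDerivAt (fun t => (Real.log t)⁻¹) (-t⁻¹ / Real.log t ^ 2) t := fun t ht =>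
    (Real.hasDerivAt_log (zero_lt_one.trans (hpos t ht)).ne').inv (Real.log_pos (hpos t ht)).ne'
  obtain ⟨i0, i1, e1⟩ := integral_deriv_inv_log_mul (c := C) hz hy
  have hint : MeasureTheory.IntegrableOn (deriv fun t => (Real.log t)⁻¹) (Set.Icc z y) := by
    rw [intervalIntegrable_iff_integrableOn_Icc_of_le hy] at i0
    exact i0.congr_fun (fun t ht => ((hd t ht).deriv).symm) measurableSet_Icc
  have hz0 : 0 ≤ z := by linarith
  have h := sum_mul_eq_sub_sub_integral_mul primeLogWeight hz0 hy
    (fun t ht => (hd t ht).differentiableAt) hint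
  have hi : IntervalIntegrable (fun t : ℝ => deriv (fun t => (Real.log t)⁻¹) t *
      ∑ k ∈ Finset.Icc 0 ⌊t⌋₊, primeLogWeight k) MeasureTheory.volume z y := by
    rw [intervalIntegrable_iff_integrableOn_Icc_of_le hy]
    exact integrableOn_mul_sum_Icc primeLogWeight (m := 0) hz0 hint
  rw [h, ← intervalIntegral.integral_of_le hy]
  have b1 := intervalIntegral.integral_mono_on hy i1 hi fun t ht => by
    rw [(hd t ht).deriv]
    have h1 := hpos t ht
    have := abs_le.1 (hC t h1.le)
    have h0 : -t⁻¹ / Real.log t ^ 2 ≤ 0 := by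
      rw [neg_div]
      have : 0 < t := by linarith
      have : 0 ≤ t⁻¹ / Real.log t ^ 2 := by positivity
      linarith
    exact mul_le_mul_of_nonpos_left (by linarith) h0
  rw [e1] at b1
  have hlz := Real.log_pos hz
  have hly := Real.log_pos (hz.trans_le hy)
  have hAz := (abs_le.1 (hC z hz.le)).1
  have hAy := (abs_le.1 (hC y (hz.le.trans hy))).2
  have c1 : (Real.log y)⁻¹ * ∑ k ∈ Finset.Icc 0 ⌊y⌋₊, primeLogWeight k ≤ 1 + C / Real.log y := by
    rw [inv_mul_le_iff₀ hly, mul_add, mul_div_cancel₀ _ hly.ne']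
    linarith
  have c2 : 1 - C / Real.log z ≤ (Real.log z)⁻¹ * ∑ k ∈ Finset.Icc 0 ⌊z⌋₊, primeLogWeight k := by
    rw [le_inv_mul_iff₀ hlz, mul_sub, mul_div_cancel₀ _ hlz.ne']
    linarith
  rw [Real.log_div hly.ne' hlz.ne', mul_div_assoc]
  linarith

theorem sum_filter_primes_le_sum_Icc {P : Finset ℕ} (hP : ∀ p ∈ P, p.Prime)
    {F : ℕ → ℝ} {z : ℝ} (hz : 0 < z) (hF : ∀ k ∈ Finset.Icc 0 ⌊z⌋₊, 0 ≤ F k) :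
    ∑ p ∈ P.filter (fun p : ℕ => Real.log p ≤ Real.log z), F p * primeLogWeight p ≤
      ∑ k ∈ Finset.Icc 0 ⌊z⌋₊, F k * primeLogWeight k := by
  refine Finset.sum_le_sum_of_subset_of_nonneg (fun p hp => ?_)
    fun k hk _ => mul_nonneg (hF k hk) (primeLogWeight_nonneg k)
  rw [Finset.mem_filter] at hp
  have hp0 : (0 : ℝ) < p := by exact_mod_cast (hP p hp.1).pos
  simp only [Finset.mem_Icc, zero_le, true_and]
  exact Nat.le_floor ((Real.log_le_log_iff hp0 hz).1 hp.2)

theorem seven_div_sub_seven_mul_log_le {p : ℕ} (hp : p.Prime) (h14 : 14 ≤ p) :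
    7 / ((p : ℝ) - 7) * Real.log p ≤
      7 * primeLogWeight p + 98 * (Real.log p / (p : ℝ) ^ 2) := by
  have h : (14 : ℝ) ≤ p := by exact_mod_cast h14
  have h1 : 7 / ((p : ℝ) - 7) ≤ 7 / p + 98 / (p : ℝ) ^ 2 := by
    rw [div_add_div _ _ (by positivity) (by positivity), div_le_div_iff₀ (by linarith)
      (by positivity)]
    nlinarith [mul_nonneg (by linarith : (0 : ℝ) ≤ p) (by linarith : (0 : ℝ) ≤ p - 14)]
  calc 7 / ((p : ℝ) - 7) * Real.log p ≤ (7 / p + 98 / (p : ℝ) ^ 2) * Real.log p :=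
        mul_le_mul_of_nonneg_right h1 (Real.log_natCast_nonneg p)
    _ = _ := by rw [primeLogWeight, if_pos hp]; ring

/-- Upper bounds for the first two logarithmic moments of the density `7 / (p - 7)`. -/
theorem exists_sum_seven_div_log_le :
    ∃ C : ℝ, 0 < C ∧ ∀ L : ℝ, 1 ≤ L → ∀ s : ℝ, 0 < s → s ≤ 1 →
      ∀ P : Finset ℕ, (∀ p ∈ P, p.Prime ∧ 14 ≤ p) →
        ∑ p ∈ P.filter (fun p : ℕ => Real.log p / L ≤ s), 7 / ((p : ℝ) - 7) * (Real.log p / L) ≤ 7 * s + C / L ∧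
        ∑ p ∈ P.filter (fun p : ℕ => Real.log p / L ≤ s),
          7 / ((p : ℝ) - 7) * (Real.log p / L) * (s - Real.log p / L) ≤
            7 / 2 * s ^ 2 + C / L := by
  obtain ⟨C, hC0, hC⟩ := exists_abs_sum_primeLogWeight_sub_log_le
  obtain ⟨C₂, hC₂, hsq⟩ := exists_sum_log_div_sq_le
  refine ⟨21 * C + 98 * C₂, by positivity, fun L hL s hs hs1 P hP => ?_⟩
  have hL0 : 0 < L := by linarith
  set z := Real.exp (s * L) with hz
  have hz0 : 0 < z := Real.exp_pos _
  have hlz : Real.log z = s * L := Real.log_exp _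
  have hsL : 0 ≤ s * L := by positivity
  have hz1 : 1 ≤ z := Real.one_le_exp hsL
  have hfil : P.filter (fun p : ℕ => Real.log p / L ≤ s) =
      P.filter (fun p : ℕ => Real.log p ≤ Real.log z) := by
    refine Finset.filter_congr fun p _ => ?_
    rw [hlz, div_le_iff₀ hL0]
  have hA := (abs_le.1 (hC z hz1)).2
  have hB := (abs_le.1 (abs_sum_log_mul_primeLogWeight_sub_le hC hz1)).1
  rw [hlz] at hA hB
  have hP' := fun p hp => (hP p hp).1
  have hS := hsq (P.filter fun p : ℕ => Real.log p ≤ Real.log z)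
  constructor
  · rw [hfil]
    have h1 := sum_filter_primes_le_sum_Icc (F := fun _ => 1) hP' hz0 (fun k _ => zero_le_one)
    simp only [one_mul] at h1
    calc ∑ p ∈ P.filter (fun p : ℕ => Real.log p ≤ Real.log z), 7 / ((p : ℝ) - 7) * (Real.log p / L)
        ≤ ∑ p ∈ P.filter (fun p : ℕ => Real.log p ≤ Real.log z),
            (7 * primeLogWeight p + 98 * (Real.log p / (p : ℝ) ^ 2)) / L := by
          refine Finset.sum_le_sum fun p hp => ?_
          obtain ⟨hp1, hp2⟩ := hP p (Finset.mem_filter.1 hp).1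
          rw [← mul_div_assoc]
          exact div_le_div_of_nonneg_right (seven_div_sub_seven_mul_log_le hp1 hp2) hL0.le
      _ ≤ (7 * (s * L + C) + 98 * C₂) / L := by
          rw [← Finset.sum_div, Finset.sum_add_distrib, ← Finset.mul_sum, ← Finset.mul_sum]
          exact div_le_div_of_nonneg_right (by linarith) hL0.le
      _ ≤ 7 * s + (21 * C + 98 * C₂) / L := by
          have : (7 * (s * L + C) + 98 * C₂) / L = 7 * s + (7 * C + 98 * C₂) / L := by
            field_simp
            ring
          rw [this]
          gcongr
          linarith
  · rw [hfil]
    have h1 := sum_filter_primes_le_sum_Icc (F := fun k => s * L - Real.log k) hP' hz0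
      (fun k hk => by
        rcases Nat.eq_zero_or_pos k with rfl | hk0
        · simpa using hsL
        · rw [← hlz, sub_nonneg]
          exact Real.log_le_log (by exact_mod_cast hk0)
            (Nat.le_floor_iff hz0.le |>.1 (Finset.mem_Icc.1 hk).2))
    simp only [sub_mul, Finset.sum_sub_distrib, ← Finset.mul_sum] at h1
    calc ∑ p ∈ P.filter (fun p : ℕ => Real.log p ≤ Real.log z),
          7 / ((p : ℝ) - 7) * (Real.log p / L) * (s - Real.log p / L)
        ≤ ∑ p ∈ P.filter (fun p : ℕ => Real.log p ≤ Real.log z),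
            (7 * (s * L * primeLogWeight p - Real.log p * primeLogWeight p) +
              98 * (s * L) * (Real.log p / (p : ℝ) ^ 2)) / L ^ 2 := by
          refine Finset.sum_le_sum fun p hp => ?_
          obtain ⟨hpP, hpz⟩ := Finset.mem_filter.1 hp
          obtain ⟨hp1, hp2⟩ := hP p hpP
          have hlp := Real.log_natCast_nonneg p
          rw [hlz] at hpz
          have e : 7 / ((p : ℝ) - 7) * (Real.log p / L) * (s - Real.log p / L) =
              7 / ((p : ℝ) - 7) * Real.log p * (s * L - Real.log p) / L ^ 2 := by
            have : s - Real.log p / L = (s * L - Real.log p) / L := by field_simp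
            rw [this]
            ring
          rw [e]
          refine div_le_div_of_nonneg_right ?_ (by positivity)
          have hq : 0 ≤ Real.log p / (p : ℝ) ^ 2 := by positivity
          have := mul_le_mul_of_nonneg_right (seven_div_sub_seven_mul_log_le hp1 hp2)
            (sub_nonneg.2 hpz)
          nlinarith
      _ ≤ (7 * ((s * L) ^ 2 / 2 + 3 * C * (s * L)) + 98 * (s * L) * C₂) / L ^ 2 := by
          rw [← Finset.sum_div, Finset.sum_add_distrib, ← Finset.mul_sum, ← Finset.mul_sum,
            Finset.sum_sub_distrib, ← Finset.mul_sum]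
          refine div_le_div_of_nonneg_right ?_ (by positivity)
          have i1 := mul_le_mul_of_nonneg_left hA hsL
          have i2 := mul_le_mul_of_nonneg_left hS hsL
          nlinarith
      _ = 7 / 2 * s ^ 2 + s * (21 * C + 98 * C₂) / L := by
          field_simp
          ring
      _ ≤ 7 / 2 * s ^ 2 + (21 * C + 98 * C₂) / L := by
          gcongr
          have : 0 ≤ 21 * C + 98 * C₂ := by positivity
          nlinarith

theorem log_two_div_le {s : ℝ} (hs : 0 < s) (hs1 : s ≤ 1) :
    s ^ 2 * (Real.log (2 / s) + s / 2 - 1 / 2) ≤ 0.9432 * s ^ 2 + 0.2 * s := by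
  have key : Real.log (1 / s) + s / 2 ≤ 0.75 + 0.2 / s := by
    have tangent : ∀ w : ℝ, 0 < w → Real.log (1 / s) ≤ Real.log w - 1 + 1 / w / s := by
      intro w hw
      have h := Real.log_le_sub_one_of_pos (show 0 < 1 / (w * s) by positivity)
      have e : Real.log (1 / s) = Real.log w + Real.log (1 / (w * s)) := by
        rw [← Real.log_mul hw.ne' (by positivity)]
        congr 1
        field_simp
      rw [e, div_div]
      linarith
    rcases le_total s 0.28 with h | h
    · have h5 := Real.log_five_lt_d9
      have := tangent 5 (by norm_num)
      have e : (1 : ℝ) / 5 / s = 0.2 / s := by norm_num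
      rw [e] at this
      linarith
    · have h3 := Real.log_three_lt_d9
      have := tangent 3 (by norm_num)
      have h2 : s / 2 + (1 / 3 - 0.2) / s ≤ 0.6513 := by
        rw [← le_sub_iff_add_le', div_le_iff₀ hs]
        nlinarith [mul_nonneg (sub_nonneg.2 h) (sub_nonneg.2 hs1)]
      rw [sub_div] at h2
      linarith
  have hl2 := Real.log_two_lt_d9
  have e : Real.log (2 / s) = Real.log 2 + Real.log (1 / s) := by
    rw [← Real.log_mul (by norm_num) (by positivity)]
    congr 1
    ring
  have h4 : Real.log (2 / s) + s / 2 - 1 / 2 ≤ 0.9432 + 0.2 / s := by linarith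
  calc s ^ 2 * (Real.log (2 / s) + s / 2 - 1 / 2) ≤ s ^ 2 * (0.9432 + 0.2 / s) := by gcongr
    _ = _ := by field_simp

/-- The sum of the weighted densities `7 / p` against the truncated squares `min u s ^ 2`, where
`u = log p / L`. -/
theorem exists_sum_weight_mul_min_sq_le :
    ∃ C : ℝ, 0 < C ∧ ∀ L : ℝ, 1 ≤ L → ∀ s : ℝ, 0 < s → s ≤ 1 → ∀ η : ℝ, 0 < η →
      ∀ Θ : ℝ, 0 ≤ Θ → ∀ P : Finset ℕ, (∀ p ∈ P, p.Prime ∧ Real.log p ≤ 2 * L) →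
        ∑ p ∈ P, (1 - Real.log p / L / 2 + if Real.log p / L ≤ η then Θ else 0) *
            (7 / (p : ℝ) * min (Real.log p / L) s ^ 2) ≤
          7 * (0.9432 * s ^ 2 + 0.2 * s) + 7 * Θ * η + C * (1 + Θ) / L := by
  obtain ⟨C, hC0, hC⟩ := exists_abs_sum_primeLogWeight_sub_log_le
  refine ⟨40 * C, by positivity, fun L hL s hs hs1 η hη Θ hΘ P hP => ?_⟩
  have hL0 : 0 < L := by linarith
  have hP' := fun p hp => (hP p hp).1
  have hsL : 0 < s * L := by positivity
  set z := Real.exp (s * L) with hz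
  set y := Real.exp (2 * L) with hy
  set t := Real.exp (η * L) with ht
  have hz0 : 0 < z := Real.exp_pos _
  have ht0 : 0 < t := Real.exp_pos _
  have hy0 : 0 < y := Real.exp_pos _
  have hlz : Real.log z = s * L := Real.log_exp _
  have hly : Real.log y = 2 * L := Real.log_exp _
  have hlt : Real.log t = η * L := Real.log_exp _
  have hz1 : 1 < z := by
    rw [hz, Real.one_lt_exp_iff]; exact hsL
  have ht1 : 1 ≤ t := Real.one_le_exp (by positivity)
  have hzy : z ≤ y := Real.exp_le_exp.2 (by nlinarith)
  have hy1 : 1 < y := hz1.trans_le hzy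
  have lo := (abs_le.1 (abs_sum_log_mul_primeLogWeight_sub_le hC hz1.le)).2
  have hi := sum_inv_log_mul_primeLogWeight_le hC hz1 hzy
  have mz := (abs_le.1 (hC z hz1.le)).2
  have my := (abs_le.1 (hC y hy1.le)).1
  have mt := (abs_le.1 (hC t ht1)).2
  rw [hlz] at lo mz
  rw [hlz, hly] at hi
  rw [hly] at my
  rw [hlt] at mt
  have lo' := sum_filter_primes_le_sum_Icc (F := fun k => Real.log k) hP' hz0
    (fun k _ => Real.log_natCast_nonneg k)
  have mt' := sum_filter_primes_le_sum_Icc (F := fun _ => 1) hP' ht0 (fun k _ => zero_le_one)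
  simp only [one_mul] at mt'
  have hfloor : ⌊z⌋₊ ≤ ⌊y⌋₊ := Nat.floor_le_floor hzy
  have split : ∑ k ∈ Finset.Icc 0 ⌊y⌋₊, primeLogWeight k =
      ∑ k ∈ Finset.Icc 0 ⌊z⌋₊, primeLogWeight k +
        ∑ k ∈ Finset.Ioc ⌊z⌋₊ ⌊y⌋₊, primeLogWeight k := by
    rw [← Finset.sum_union]
    · congr 1
      ext k
      simp only [Finset.mem_Icc, Finset.mem_union, Finset.mem_Ioc]
      omega
    · rw [Finset.disjoint_left]
      intro k
      simp only [Finset.mem_Icc, Finset.mem_Ioc]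
      omega
  have hi' : ∑ p ∈ P.filter (fun p : ℕ => ¬ Real.log p ≤ Real.log z),
      ((Real.log p)⁻¹ - 1 / (2 * L)) * primeLogWeight p ≤
      ∑ k ∈ Finset.Ioc ⌊z⌋₊ ⌊y⌋₊, ((Real.log k)⁻¹ - 1 / (2 * L)) * primeLogWeight k := by
    refine Finset.sum_le_sum_of_subset_of_nonneg (fun p hp => ?_)
      fun k hk _ => mul_nonneg ?_ (primeLogWeight_nonneg k)
    · rw [Finset.mem_filter] at hp
      have hp0 : (0 : ℝ) < p := by exact_mod_cast (hP' p hp.1).pos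
      rw [Finset.mem_Ioc]
      refine ⟨(Nat.floor_lt hz0.le).2 ((Real.log_lt_log_iff hz0 hp0).1 (not_le.1 hp.2)),
        Nat.le_floor ((Real.log_le_log_iff hp0 hy0).1 ?_)⟩
      rw [hly]
      exact (hP p hp.1).2
    · rw [Finset.mem_Ioc] at hk
      have h1 : z < k := (Nat.floor_lt hz0.le).1 hk.1
      have h2 : (k : ℝ) ≤ y := (Nat.le_floor_iff hy0.le).1 hk.2
      have h3 : 0 < Real.log k := Real.log_pos (hz1.trans h1)
      have h4 : Real.log k ≤ 2 * L := by
        rw [← hly]; exact Real.log_le_log (hz0.trans h1) h2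
      rw [sub_nonneg, one_div]
      exact inv_anti₀ h3 h4
  simp only [sub_mul, Finset.sum_sub_distrib, ← Finset.mul_sum] at hi'
  have pw : ∀ p ∈ P, (1 - Real.log p / L / 2 + if Real.log p / L ≤ η then Θ else 0) *
      (7 / (p : ℝ) * min (Real.log p / L) s ^ 2) ≤
      (if Real.log p ≤ Real.log z then 7 / L ^ 2 * (Real.log p * primeLogWeight p) else 0) +
      (if ¬ Real.log p ≤ Real.log z then
        7 * s ^ 2 * ((Real.log p)⁻¹ * primeLogWeight p - 1 / (2 * L) * primeLogWeight p) else 0) +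
      (if Real.log p ≤ Real.log t then 7 * Θ / L * primeLogWeight p else 0) := by
    intro p hp
    obtain ⟨hpp, hp2⟩ := hP p hp
    have hp0 : (0 : ℝ) < p := by exact_mod_cast hpp.pos
    have hlp : 0 < Real.log p := Real.log_pos (by exact_mod_cast hpp.one_lt)
    have hu : 0 < Real.log p / L := by positivity
    have hw : primeLogWeight p = Real.log p / p := if_pos hpp
    have ez : (Real.log p ≤ Real.log z) ↔ Real.log p / L ≤ s := by
      rw [hlz, div_le_iff₀ hL0]
    have et : (Real.log p ≤ Real.log t) ↔ Real.log p / L ≤ η := by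
      rw [hlt, div_le_iff₀ hL0]
    rw [add_mul]
    refine add_le_add ?_ ?_
    · simp only [ez]
      split_ifs with h
      · rw [min_eq_left h, add_zero]
        have e : 7 / L ^ 2 * (Real.log p * primeLogWeight p) =
            1 * (7 / (p : ℝ) * (Real.log p / L) ^ 2) := by
          rw [hw]; field_simp
        rw [e]
        gcongr
        linarith
      · rw [min_eq_right (not_le.1 h).le, zero_add, hw]
        apply le_of_eq
        field_simp
    · simp only [et]
      split_ifs with h
      · have e : 7 * Θ / L * primeLogWeight p = Θ * (7 / (p : ℝ) * (Real.log p / L)) := by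
          rw [hw]; field_simp
        rw [e]
        gcongr
        have h1 := min_le_left (Real.log p / L) s
        have h2 := min_le_right (Real.log p / L) s
        have h3 : 0 < min (Real.log p / L) s := lt_min hu hs
        nlinarith
      · simp
  refine (Finset.sum_le_sum pw).trans ?_
  rw [Finset.sum_add_distrib, Finset.sum_add_distrib, ← Finset.sum_filter, ← Finset.sum_filter,
    ← Finset.sum_filter, ← Finset.mul_sum, ← Finset.mul_sum, ← Finset.mul_sum,
    Finset.sum_sub_distrib, ← Finset.mul_sum]
  have b1 : 7 / L ^ 2 * ∑ p ∈ P.filter (fun p : ℕ => Real.log p ≤ Real.log z),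
      Real.log p * primeLogWeight p ≤ 7 * s ^ 2 / 2 + 14 * C / L := by
    calc _ ≤ 7 / L ^ 2 * ((s * L) ^ 2 / 2 + 2 * C * (s * L)) := by
          gcongr
          linarith
      _ = 7 * s ^ 2 / 2 + s * (14 * C / L) := by
          field_simp
          ring
      _ ≤ _ := by
          have h := mul_le_of_le_one_left (show 0 ≤ 14 * C / L by positivity) hs1
          linarith
  have b3 : 7 * Θ / L * ∑ p ∈ P.filter (fun p : ℕ => Real.log p ≤ Real.log t),
      primeLogWeight p ≤ 7 * Θ * η + 7 * C * Θ / L := by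
    calc _ ≤ 7 * Θ / L * (η * L + C) := by
          gcongr
          linarith
      _ = _ := by field_simp
  have b2 : 7 * s ^ 2 * (∑ p ∈ P.filter (fun p : ℕ => ¬ Real.log p ≤ Real.log z),
      (Real.log p)⁻¹ * primeLogWeight p -
      1 / (2 * L) * ∑ p ∈ P.filter (fun p : ℕ => ¬ Real.log p ≤ Real.log z), primeLogWeight p) ≤
      7 * s ^ 2 * (Real.log (2 / s) - 1 + s / 2) + 21 * C / L := by
    have h1 : 1 / (2 * L) * (2 * L - C - (s * L + C)) ≤
        1 / (2 * L) * ∑ k ∈ Finset.Ioc ⌊z⌋₊ ⌊y⌋₊, primeLogWeight k := by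
      gcongr
      linarith
    have h2 : 1 / (2 * L) * (2 * L - C - (s * L + C)) = 1 - s / 2 - C / L := by
      field_simp
      ring
    have h3 : Real.log (2 * L / (s * L)) = Real.log (2 / s) := by
      congr 1
      field_simp
    rw [h3] at hi
    have h4 : 7 * s ^ 2 * (2 * C / (s * L)) = s * (14 * C / L) := by field_simp; norm_num
    have h5 : 0 ≤ C / L := by positivity
    have h6 : s ^ 2 ≤ 1 := pow_le_one₀ hs.le hs1
    calc _ ≤ 7 * s ^ 2 * (Real.log (2 / s) - 1 + s / 2 + (2 * C / (s * L)) + C / L) := by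
          gcongr
          linarith
      _ = 7 * s ^ 2 * (Real.log (2 / s) - 1 + s / 2) + s * (14 * C / L) + 7 * s ^ 2 * (C / L) := by
          rw [← h4]; ring
      _ ≤ _ := by
          have e1 : 14 * C / L = 14 * (C / L) := by ring
          have e2 : 21 * C / L = 21 * (C / L) := by ring
          rw [e1, e2]
          have e3 := mul_le_of_le_one_left h5 hs1
          have e4 := mul_le_of_le_one_left h5 h6
          linarith
  have h7 := log_two_div_le hs hs1
  have h8 : 40 * C * (1 + Θ) / L = 40 * (C / L) + 40 * (C * Θ / L) := by field_simp
  have h9 : 14 * C / L = 14 * (C / L) := by ring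
  have h10 : 21 * C / L = 21 * (C / L) := by ring
  have h11 : 7 * C * Θ / L = 7 * (C * Θ / L) := by ring
  have h12 : 0 ≤ C / L := by positivity
  have h13 : 0 ≤ C * Θ / L := by positivity
  linarith

/-- The total mass of the density `7 / (p - 7)` up to `exp (2 * L)`. -/
theorem exists_sum_seven_div_le :
    ∃ C : ℝ, 0 < C ∧ ∀ L : ℝ, 1 ≤ L →
      ∀ P : Finset ℕ, (∀ p ∈ P, p.Prime ∧ 14 ≤ p ∧ Real.log p ≤ 2 * L) →
        ∑ p ∈ P, 7 / ((p : ℝ) - 7) ≤ 7 * Real.log L + C := by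
  obtain ⟨C, hC0, hC⟩ := exists_abs_sum_primeLogWeight_sub_log_le
  obtain ⟨C₂, hC₂, hsq⟩ := exists_sum_log_div_sq_le
  refine ⟨7 * (Real.log 2 - Real.log (Real.log 2)) + 14 * C / Real.log 2 + 98 * C₂ + 100,
    ?_, fun L hL P hP => ?_⟩
  · have h1 : Real.log (Real.log 2) < Real.log 2 :=
      Real.log_lt_log (Real.log_pos (by norm_num)) (by linarith [Real.log_two_lt_d9])
    have : 0 < Real.log 2 := Real.log_pos (by norm_num)
    have : 0 < 14 * C / Real.log 2 := by positivity
    linarith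
  have hl2 : 0 < Real.log 2 := Real.log_pos (by norm_num)
  set y := Real.exp (2 * L) with hy
  have hly : Real.log y = 2 * L := Real.log_exp _
  have hy0 : 0 < y := Real.exp_pos _
  have h2y : 2 ≤ y := by
    have := Real.add_one_le_exp (2 * L)
    linarith
  have hi := sum_inv_log_mul_primeLogWeight_le hC (by norm_num : (1 : ℝ) < 2) h2y
  rw [hly] at hi
  have hsub : ∑ p ∈ P, (Real.log p)⁻¹ * primeLogWeight p ≤
      ∑ k ∈ Finset.Ioc ⌊(2 : ℝ)⌋₊ ⌊y⌋₊, (Real.log k)⁻¹ * primeLogWeight k := by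
    refine Finset.sum_le_sum_of_subset_of_nonneg (fun p hp => ?_)
      fun k _ _ => mul_nonneg (inv_nonneg.2 (Real.log_natCast_nonneg k)) (primeLogWeight_nonneg k)
    obtain ⟨h1, h2, h3⟩ := hP p hp
    have hp0 : (0 : ℝ) < p := by exact_mod_cast h1.pos
    rw [Finset.mem_Ioc]
    refine ⟨?_, Nat.le_floor ((Real.log_le_log_iff hp0 hy0).1 (by rw [hly]; exact h3))⟩
    rw [Nat.floor_ofNat]
    omega
  have hlog : Real.log (2 * L / Real.log 2) =
      Real.log 2 + Real.log L - Real.log (Real.log 2) := by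
    rw [Real.log_div (by positivity) hl2.ne', Real.log_mul (by norm_num) (by positivity)]
  rw [hlog] at hi
  have hS := hsq P
  have pw : ∀ p ∈ P, 7 / ((p : ℝ) - 7) ≤
      7 * ((Real.log p)⁻¹ * primeLogWeight p) + 98 * (Real.log p / (p : ℝ) ^ 2) := by
    intro p hp
    obtain ⟨h1, h2, h3⟩ := hP p hp
    have h14 : (14 : ℝ) ≤ p := by exact_mod_cast h2
    have hl1 : 1 ≤ Real.log p := by
      rw [Real.le_log_iff_exp_le (by linarith)]
      linarith [Real.exp_one_lt_d9]
    have h := seven_div_sub_seven_mul_log_le h1 h2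
    calc 7 / ((p : ℝ) - 7) = (7 / ((p : ℝ) - 7) * Real.log p) * (Real.log p)⁻¹ := by
          rw [mul_assoc, mul_inv_cancel₀ (by linarith), mul_one]
      _ ≤ (7 * primeLogWeight p + 98 * (Real.log p / (p : ℝ) ^ 2)) * (Real.log p)⁻¹ := by
          gcongr
      _ = 7 * ((Real.log p)⁻¹ * primeLogWeight p) +
            98 * (Real.log p / (p : ℝ) ^ 2) * (Real.log p)⁻¹ := by ring
      _ ≤ _ := by
          exact add_le_add le_rfl
            (mul_le_of_le_one_right (by positivity) (inv_le_one_of_one_le₀ hl1))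
  refine (Finset.sum_le_sum pw).trans ?_
  rw [Finset.sum_add_distrib, ← Finset.mul_sum, ← Finset.mul_sum]
  have e : 14 * C / Real.log 2 = 7 * (2 * C / Real.log 2) := by ring
  rw [e]
  nlinarith

/-- The coefficients of the Selberg sieve attached to the densities `g` and `h` and to the
diagonalising function `y`. -/
noncomputable def selbergCoeff (g h : ℕ → ℝ) (y : Finset ℕ → ℝ) (P D : Finset ℕ) : ℝ :=
  (-1) ^ D.card * (∏ p ∈ D, g p)⁻¹ *
    ∑ S ∈ P.powerset, if D ⊆ S then (∏ p ∈ S, h p) * y S else 0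

theorem sum_neg_one_pow_card_between {P S₀ S : Finset ℕ} (hS : S ⊆ P) :
    ∑ D ∈ P.powerset, (if S₀ ⊆ D ∧ D ⊆ S then (-1 : ℝ) ^ D.card else 0) =
      if S = S₀ then (-1) ^ S₀.card else 0 := by
  rw [← Finset.sum_filter]
  have e : P.powerset.filter (fun D => S₀ ⊆ D ∧ D ⊆ S) = Finset.Icc S₀ S := by
    ext D
    simp only [Finset.mem_filter, Finset.mem_powerset, Finset.mem_Icc]
    exact ⟨fun h => h.2, fun h => ⟨h.2.trans hS, h⟩⟩
  rw [e]
  by_cases h : S₀ ⊆ S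
  · rw [Finset.Icc_eq_image_powerset h, Finset.sum_image]
    · have : ∀ T ∈ (S \ S₀).powerset, (-1 : ℝ) ^ (S₀ ∪ T).card =
          (-1) ^ S₀.card * ((-1 : ℤ) ^ T.card : ℤ) := fun T hT => by
        rw [Finset.card_union_of_disjoint, pow_add]
        · push_cast; rfl
        · exact Finset.disjoint_sdiff.mono_right (Finset.mem_powerset.1 hT)
      rw [Finset.sum_congr rfl this, ← Finset.mul_sum, ← Int.cast_sum,
        Finset.sum_powerset_neg_one_pow_card]
      have : S \ S₀ = ∅ ↔ S = S₀ := by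
        rw [Finset.sdiff_eq_empty_iff_subset]
        exact ⟨fun h' => h'.antisymm h, fun h' => h'.subset⟩
      simp [this]
    · intro T hT T' hT' hTT
      have hd : ∀ T ∈ ((S \ S₀).powerset : Set (Finset ℕ)), (S₀ ∪ T) \ S₀ = T := fun T hT => by
        rw [Finset.union_sdiff_cancel_left]
        exact Finset.disjoint_sdiff.mono_right (Finset.mem_powerset.1 hT)
      simp only at hTT
      rw [← hd T hT, ← hd T' hT', hTT]
  · rw [Finset.Icc_eq_empty (by simpa using h), Finset.sum_empty, if_neg]
    rintro rfl
    exact h Finset.Subset.rfl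

theorem sum_prod_mul_selbergCoeff {g h : ℕ → ℝ} (y : Finset ℕ → ℝ) {P S₀ : Finset ℕ}
    (hg : ∀ p ∈ P, g p ≠ 0) (hS₀ : S₀ ⊆ P) :
    ∑ D ∈ P.powerset, (if S₀ ⊆ D then (∏ p ∈ D, g p) * selbergCoeff g h y P D else 0) =
      (-1) ^ S₀.card * ((∏ p ∈ S₀, h p) * y S₀) := by
  have h1 : ∀ D ∈ P.powerset,
      (if S₀ ⊆ D then (∏ p ∈ D, g p) * selbergCoeff g h y P D else 0) =
        ∑ S ∈ P.powerset, ((∏ p ∈ S, h p) * y S) *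
          (if S₀ ⊆ D ∧ D ⊆ S then (-1 : ℝ) ^ D.card else 0) := by
    intro D hD
    have hgD : ∏ p ∈ D, g p ≠ 0 :=
      Finset.prod_ne_zero_iff.2 fun p hp => hg p (Finset.mem_powerset.1 hD hp)
    split_ifs with hs
    · rw [selbergCoeff, mul_comm ((-1 : ℝ) ^ _), mul_assoc, mul_inv_cancel_left₀ hgD,
        Finset.mul_sum]
      refine Finset.sum_congr rfl fun S _ => ?_
      simp only [hs, true_and]
      split_ifs <;> ring
    · simp [hs]
  rw [Finset.sum_congr rfl h1, Finset.sum_comm]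
  have h2 : ∀ S ∈ P.powerset, ∑ D ∈ P.powerset, ((∏ p ∈ S, h p) * y S) *
        (if S₀ ⊆ D ∧ D ⊆ S then (-1 : ℝ) ^ D.card else 0) =
      if S = S₀ then (-1) ^ S₀.card * ((∏ p ∈ S₀, h p) * y S₀) else 0 := by
    intro S hS
    rw [← Finset.mul_sum, sum_neg_one_pow_card_between (Finset.mem_powerset.1 hS)]
    split_ifs with hs
    · rw [hs, mul_comm]
    · rw [mul_zero]
  rw [Finset.sum_congr rfl h2, Finset.sum_ite_eq' P.powerset S₀, if_pos (Finset.mem_powerset.2 hS₀)]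

theorem prod_union_eq_mul_sum {g h : ℕ → ℝ} {P D E : Finset ℕ}
    (hg : ∀ p ∈ P, g p ≠ 0) (hgh : ∀ p ∈ P, (g p)⁻¹ = 1 + (h p)⁻¹) (hD : D ⊆ P) :
    ∏ p ∈ D ∪ E, g p = ∑ S ∈ P.powerset, (∏ p ∈ S, h p)⁻¹ *
      ((if S ⊆ D then ∏ p ∈ D, g p else 0) * (if S ⊆ E then ∏ p ∈ E, g p else 0)) := by
  have hsub : D ∩ E ⊆ P := Finset.inter_subset_left.trans hD
  have h1 := Finset.prod_union_inter (s₁ := D) (s₂ := E) (f := g)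
  have h2 : ∏ p ∈ D ∩ E, g p ≠ 0 := Finset.prod_ne_zero_iff.2 fun p hp => hg p (hsub hp)
  have h3 : (∏ p ∈ D ∩ E, g p)⁻¹ = ∑ S ∈ (D ∩ E).powerset, (∏ p ∈ S, h p)⁻¹ := by
    rw [← Finset.prod_inv_distrib, Finset.prod_congr rfl fun p hp => hgh p (hsub hp),
      Finset.prod_one_add]
    simp
  rw [(eq_mul_inv_iff_mul_eq₀ h2).2 h1, h3, Finset.mul_sum]
  have h4 : (D ∩ E).powerset = P.powerset.filter fun S => S ⊆ D ∧ S ⊆ E := by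
    ext S
    simp only [Finset.mem_powerset, Finset.mem_filter, Finset.subset_inter_iff]
    exact ⟨fun h => ⟨h.1.trans hD, h⟩, fun h => h.2⟩
  rw [h4, Finset.sum_filter]
  refine Finset.sum_congr rfl fun S _ => ?_
  by_cases a : S ⊆ D <;> by_cases b : S ⊆ E <;> simp [a, b, mul_comm]

/-- Diagonalisation of the Selberg quadratic form. -/
theorem sum_sum_selbergCoeff_mul {g h : ℕ → ℝ} (y : Finset ℕ → ℝ) {P : Finset ℕ}
    (hg : ∀ p ∈ P, g p ≠ 0) (hh : ∀ p ∈ P, h p ≠ 0)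
    (hgh : ∀ p ∈ P, (g p)⁻¹ = 1 + (h p)⁻¹) :
    ∑ D ∈ P.powerset, ∑ E ∈ P.powerset,
      selbergCoeff g h y P D * selbergCoeff g h y P E * ∏ p ∈ D ∪ E, g p =
      ∑ S ∈ P.powerset, (∏ p ∈ S, h p) * y S ^ 2 := by
  have h1 : ∀ D ∈ P.powerset, ∀ E ∈ P.powerset,
      selbergCoeff g h y P D * selbergCoeff g h y P E * ∏ p ∈ D ∪ E, g p =
      ∑ S ∈ P.powerset, (∏ p ∈ S, h p)⁻¹ *
      ((if S ⊆ D then (∏ p ∈ D, g p) * selbergCoeff g h y P D else 0) *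
        (if S ⊆ E then (∏ p ∈ E, g p) * selbergCoeff g h y P E else 0)) := by
    intro D hD E hE
    rw [prod_union_eq_mul_sum hg hgh (Finset.mem_powerset.1 hD), Finset.mul_sum]
    refine Finset.sum_congr rfl fun S _ => ?_
    split_ifs <;> ring
  rw [Finset.sum_congr rfl fun D hD => Finset.sum_congr rfl (h1 D hD)]
  rw [Finset.sum_congr rfl fun D _ => Finset.sum_comm, Finset.sum_comm]
  refine Finset.sum_congr rfl fun S hS => ?_
  simp_rw [← Finset.mul_sum]
  rw [← Finset.sum_mul, sum_prod_mul_selbergCoeff y hg (Finset.mem_powerset.1 hS)]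
  have h2 : ∏ p ∈ S, h p ≠ 0 :=
    Finset.prod_ne_zero_iff.2 fun p hp => hh p (Finset.mem_powerset.1 hS hp)
  have h3 : ((-1 : ℝ) ^ S.card) * (-1) ^ S.card = 1 := by
    rw [← mul_pow]; simp
  calc _ = ((-1 : ℝ) ^ S.card * (-1) ^ S.card) * ((∏ p ∈ S, h p)⁻¹ * ∏ p ∈ S, h p) *
        ((∏ p ∈ S, h p) * y S ^ 2) := by ring
    _ = _ := by rw [h3, inv_mul_cancel₀ h2, one_mul, one_mul]

theorem selbergCoeff_add_selbergCoeff_insert {g h : ℕ → ℝ} (y : Finset ℕ → ℝ) {P D : Finset ℕ}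
    {p : ℕ} (hp : p ∉ P) (hhp : h p ≠ 0) (hghp : (g p)⁻¹ = 1 + (h p)⁻¹)
    (hD : D ⊆ P) :
    selbergCoeff g h y (insert p P) D + selbergCoeff g h y (insert p P) (insert p D) =
      selbergCoeff g h (fun S => y S - y (insert p S)) P D := by
  have hpD : p ∉ D := fun h => hp (hD h)
  have hpS : ∀ S ∈ P.powerset, p ∉ S := fun S hS h => hp (Finset.mem_powerset.1 hS h)
  simp only [selbergCoeff]
  rw [Finset.sum_powerset_insert hp, Finset.sum_powerset_insert hp, Finset.card_insert_of_notMem hpD,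
    Finset.prod_insert hpD]
  have e1 : ∑ S ∈ P.powerset, (if insert p D ⊆ S then (∏ q ∈ S, h q) * y S else 0) = 0 :=
    Finset.sum_eq_zero fun S hS => if_neg fun h => hpS S hS (h (Finset.mem_insert_self p D))
  have e2 : ∀ S ∈ P.powerset, (if insert p D ⊆ insert p S then
      (∏ q ∈ insert p S, h q) * y (insert p S) else 0) =
      h p * if D ⊆ S then (∏ q ∈ S, h q) * y (insert p S) else 0 := fun S hS => by
    simp only [Finset.insert_subset_insert_iff hpD, Finset.prod_insert (hpS S hS)]
    split_ifs <;> ring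
  have e3 : ∀ S ∈ P.powerset, (if D ⊆ insert p S then
      (∏ q ∈ insert p S, h q) * y (insert p S) else 0) =
      h p * if D ⊆ S then (∏ q ∈ S, h q) * y (insert p S) else 0 := fun S hS => by
    simp only [Finset.subset_insert_iff_of_notMem hpD, Finset.prod_insert (hpS S hS)]
    split_ifs <;> ring
  have e4 : ∑ S ∈ P.powerset, (if D ⊆ S then (∏ q ∈ S, h q) * (y S - y (insert p S)) else 0) =
      ∑ S ∈ P.powerset, (if D ⊆ S then (∏ q ∈ S, h q) * y S else 0) -
      ∑ S ∈ P.powerset, (if D ⊆ S then (∏ q ∈ S, h q) * y (insert p S) else 0) := by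
    rw [← Finset.sum_sub_distrib]
    refine Finset.sum_congr rfl fun S _ => ?_
    split_ifs <;> ring
  rw [e1, Finset.sum_congr rfl e2, Finset.sum_congr rfl e3, e4, ← Finset.mul_sum, mul_inv, hghp]
  field_simp
  ring

/-- The Selberg quadratic form restricted to multiples of a prime. -/
theorem sum_sum_selbergCoeff_mul_insert {g h : ℕ → ℝ} (y : Finset ℕ → ℝ) {P : Finset ℕ} {p : ℕ}
    (hp : p ∈ P) (hg : ∀ p ∈ P, g p ≠ 0) (hh : ∀ p ∈ P, h p ≠ 0)
    (hgh : ∀ p ∈ P, (g p)⁻¹ = 1 + (h p)⁻¹) :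
    ∑ D ∈ P.powerset, ∑ E ∈ P.powerset,
      selbergCoeff g h y P D * selbergCoeff g h y P E * ∏ q ∈ insert p (D ∪ E), g q =
      g p * ∑ S ∈ (P.erase p).powerset, (∏ q ∈ S, h q) * (y S - y (insert p S)) ^ 2 := by
  have hp' : p ∉ P.erase p := Finset.notMem_erase p P
  have hsub : ∀ q ∈ P.erase p, q ∈ P := fun q hq => Finset.mem_of_mem_erase hq
  rw [← sum_sum_selbergCoeff_mul (fun S => y S - y (insert p S)) (fun q hq => hg q (hsub q hq))
    (fun q hq => hh q (hsub q hq)) (fun q hq => hgh q (hsub q hq))]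
  have hPeq : P = insert p (P.erase p) := (Finset.insert_erase hp).symm
  set P' := P.erase p with hP'
  rw [hPeq, Finset.sum_powerset_insert hp', Finset.mul_sum, ← Finset.sum_add_distrib]
  refine Finset.sum_congr rfl fun D hD => ?_
  rw [Finset.sum_powerset_insert hp', Finset.sum_powerset_insert hp', Finset.mul_sum,
    ← Finset.sum_add_distrib, ← Finset.sum_add_distrib, ← Finset.sum_add_distrib]
  refine Finset.sum_congr rfl fun E hE => ?_
  have hpDE : p ∉ D ∪ E := by
    rw [Finset.mem_union]
    rintro (h | h)
    · exact hp' (Finset.mem_powerset.1 hD h)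
    · exact hp' (Finset.mem_powerset.1 hE h)
  rw [← selbergCoeff_add_selbergCoeff_insert y hp' (hh p hp) (hgh p hp)
      (Finset.mem_powerset.1 hD),
    ← selbergCoeff_add_selbergCoeff_insert y hp' (hh p hp) (hgh p hp)
      (Finset.mem_powerset.1 hE)]
  simp only [Finset.insert_union, Finset.union_insert, Finset.insert_idem]
  rw [Finset.prod_insert hpDE]
  ring

/-- The amount by which the product of `S` falls short of `exp L`, on a logarithmic scale. -/
noncomputable def logDefect (L : ℝ) (S : Finset ℕ) : ℝ := 1 - ∑ p ∈ S, Real.log p / L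

theorem logDefect_empty (L : ℝ) : logDefect L ∅ = 1 := by simp [logDefect]

theorem logDefect_insert (L : ℝ) {S : Finset ℕ} {p : ℕ} (hp : p ∉ S) :
    logDefect L (insert p S) = logDefect L S - Real.log p / L := by
  rw [logDefect, logDefect, Finset.sum_insert hp]
  ring

theorem logDefect_le_one {L : ℝ} (hL : 0 < L) (S : Finset ℕ) : logDefect L S ≤ 1 := by
  rw [logDefect, sub_le_self_iff]
  exact Finset.sum_nonneg fun p _ => div_nonneg (Real.log_natCast_nonneg p) hL.le

/-- The sum of the products of `h` over the subsets of `P` whose product is less than `exp L`. -/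
noncomputable def selbergMass (h : ℕ → ℝ) (L : ℝ) (P : Finset ℕ) : ℝ :=
  ∑ S ∈ P.powerset, if 0 < logDefect L S then ∏ p ∈ S, h p else 0

theorem one_le_selbergMass {h : ℕ → ℝ} {P : Finset ℕ} (hh : ∀ p ∈ P, 0 ≤ h p) (L : ℝ) :
    1 ≤ selbergMass h L P := by
  have := Finset.single_le_sum (s := P.powerset)
    (f := fun S => if 0 < logDefect L S then ∏ p ∈ S, h p else 0)
    (fun S hS => by
      split_ifs
      · exact Finset.prod_nonneg fun p hp => hh p (Finset.mem_powerset.1 hS hp)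
      · exact le_rfl) (Finset.empty_mem_powerset P)
  simpa [logDefect_empty, selbergMass] using this

theorem selbergMass_le {h : ℕ → ℝ} {P : Finset ℕ} (hh : ∀ p ∈ P, 0 ≤ h p) (L : ℝ) :
    selbergMass h L P ≤ Real.exp (∑ p ∈ P, h p) := by
  calc selbergMass h L P ≤ ∑ S ∈ P.powerset, ∏ p ∈ S, h p := by
        refine Finset.sum_le_sum fun S hS => ?_
        split_ifs
        · exact le_rfl
        · exact Finset.prod_nonneg fun p hp => hh p (Finset.mem_powerset.1 hS hp)
    _ = ∏ p ∈ P, (1 + h p) := (Finset.prod_one_add P).symm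
    _ ≤ ∏ p ∈ P, Real.exp (h p) := Finset.prod_le_prod
        (fun p hp => by linarith [hh p hp])
        (fun p _ => by linarith [Real.add_one_le_exp (h p)])
    _ = _ := (Real.exp_sum P h).symm

theorem sum_prod_mul_one_sub_logDefect_le {h : ℕ → ℝ} {P : Finset ℕ} (hh : ∀ p ∈ P, 0 ≤ h p)
    {L : ℝ} (hL : 0 < L) {φ : ℝ → ℝ} (hφ : ∀ t, 0 ≤ φ t) :
    ∑ S ∈ P.powerset, (∏ p ∈ S, h p) * φ (logDefect L S) * (1 - logDefect L S) ≤
      ∑ S ∈ P.powerset, (∏ p ∈ S, h p) *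
        ∑ p ∈ P, h p * (Real.log p / L) * φ (logDefect L S - Real.log p / L) := by
  have hu : ∀ p : ℕ, 0 ≤ Real.log p / L := fun p => div_nonneg (Real.log_natCast_nonneg p) hL.le
  have hS0 : ∀ S ∈ P.powerset, 0 ≤ ∏ p ∈ S, h p := fun S hS =>
    Finset.prod_nonneg fun p hp => hh p (Finset.mem_powerset.1 hS hp)
  have e1 : ∀ S ∈ P.powerset, (∏ p ∈ S, h p) * φ (logDefect L S) * (1 - logDefect L S) =
      ∑ p ∈ P, if p ∈ S then (∏ p ∈ S, h p) * φ (logDefect L S) * (Real.log p / L) else 0 := by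
    intro S hS
    rw [← Finset.sum_filter, ← Finset.mul_sum, Finset.filter_mem_eq_inter,
      Finset.inter_eq_right.2 (Finset.mem_powerset.1 hS), logDefect]
    ring
  rw [Finset.sum_congr rfl e1, Finset.sum_comm]
  simp_rw [Finset.mul_sum]
  rw [Finset.sum_comm (s := P.powerset)]
  refine Finset.sum_le_sum fun p hp => ?_
  have hp' : p ∉ P.erase p := Finset.notMem_erase p P
  have hpS : ∀ S ∈ (P.erase p).powerset, p ∉ S := fun S hS h =>
    hp' (Finset.mem_powerset.1 hS h)
  have hPeq : P.powerset = (insert p (P.erase p)).powerset := by rw [Finset.insert_erase hp]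
  rw [hPeq, Finset.sum_powerset_insert hp', Finset.sum_eq_zero fun S hS => if_neg (hpS S hS),
    zero_add, ← hPeq]
  calc _ = ∑ S ∈ (P.erase p).powerset, (∏ p ∈ S, h p) *
        (h p * (Real.log p / L) * φ (logDefect L S - Real.log p / L)) := by
        refine Finset.sum_congr rfl fun S hS => ?_
        rw [if_pos (Finset.mem_insert_self p S), logDefect_insert L (hpS S hS),
          Finset.prod_insert (hpS S hS)]
        ring
    _ ≤ _ := Finset.sum_le_sum_of_subset_of_nonneg
        (Finset.powerset_mono.2 (Finset.erase_subset p P)) fun S hS _ =>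
        mul_nonneg (hS0 S hS) (mul_nonneg (mul_nonneg (hh p hp) (hu p)) (hφ _))

theorem seven_div_sub_seven_nonneg {p : ℕ} (hp : 14 ≤ p) : 0 ≤ 7 / ((p : ℝ) - 7) := by
  have : (14 : ℝ) ≤ p := by exact_mod_cast hp
  exact div_nonneg (by norm_num) (by linarith)

theorem sum_ite_logDefect_mul_add {h : ℕ → ℝ} {L : ℝ} {P : Finset ℕ} (a b c : ℝ) :
    ∑ S ∈ P.powerset, (∏ p ∈ S, h p) *
      (if 0 < logDefect L S then a * logDefect L S ^ 2 + b * logDefect L S + c else 0) =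
    a * ∑ S ∈ P.powerset, (∏ p ∈ S, h p) * (max 0 (logDefect L S)) ^ 2 +
      b * ∑ S ∈ P.powerset, (∏ p ∈ S, h p) * max 0 (logDefect L S) + c * selbergMass h L P := by
  rw [selbergMass, Finset.mul_sum, Finset.mul_sum, Finset.mul_sum, ← Finset.sum_add_distrib,
    ← Finset.sum_add_distrib]
  refine Finset.sum_congr rfl fun S _ => ?_
  split_ifs with hs
  · rw [max_eq_right hs.le]; ring
  · rw [max_eq_left (not_lt.1 hs)]; ring

/-- Comparison of the zeroth, first and second moments of the logarithmic defect. -/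
theorem exists_selbergMass_le_moments :
    ∃ C : ℝ, 0 < C ∧ ∀ L : ℝ, 1 ≤ L → ∀ P : Finset ℕ, (∀ p ∈ P, p.Prime ∧ 14 ≤ p) →
      selbergMass (fun p => 7 / ((p : ℝ) - 7)) L P ≤
        8 * (∑ S ∈ P.powerset, (∏ p ∈ S, 7 / ((p : ℝ) - 7)) * max 0 (logDefect L S)) +
          C / L * selbergMass (fun p => 7 / ((p : ℝ) - 7)) L P ∧
      ∑ S ∈ P.powerset, (∏ p ∈ S, 7 / ((p : ℝ) - 7)) * max 0 (logDefect L S) ≤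
        9 / 2 * (∑ S ∈ P.powerset, (∏ p ∈ S, 7 / ((p : ℝ) - 7)) * max 0 (logDefect L S) ^ 2) +
          C / L * selbergMass (fun p => 7 / ((p : ℝ) - 7)) L P := by
  obtain ⟨C, hC0, hC⟩ := exists_sum_seven_div_log_le
  refine ⟨C, hC0, fun L hL P hP => ?_⟩
  have hL0 : 0 < L := by linarith
  have hh : ∀ p ∈ P, (0 : ℝ) ≤ 7 / ((p : ℝ) - 7) := fun p hp =>
    seven_div_sub_seven_nonneg (hP p hp).2
  have hu : ∀ p : ℕ, 0 ≤ Real.log p / L := fun p => div_nonneg (Real.log_natCast_nonneg p) hL0.le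
  have hS0 : ∀ S ∈ P.powerset, (0 : ℝ) ≤ ∏ p ∈ S, 7 / ((p : ℝ) - 7) := fun S hS =>
    Finset.prod_nonneg fun p hp => hh p (Finset.mem_powerset.1 hS hp)
  have k0 := sum_prod_mul_one_sub_logDefect_le hh hL0 (φ := fun t => if 0 < t then 1 else 0)
    (fun t => by positivity)
  have k1 := sum_prod_mul_one_sub_logDefect_le hh hL0 (φ := fun t => max 0 t)
    (fun t => le_max_left 0 t)
  have r0 := sum_ite_logDefect_mul_add (h := fun p => 7 / ((p : ℝ) - 7)) (L := L) (P := P)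
    0 7 (C / L)
  have r1 := sum_ite_logDefect_mul_add (h := fun p => 7 / ((p : ℝ) - 7)) (L := L) (P := P)
    (7 / 2) 0 (C / L)
  have b0 : ∑ S ∈ P.powerset, (∏ p ∈ S, 7 / ((p : ℝ) - 7)) *
        ∑ p ∈ P, 7 / ((p : ℝ) - 7) * (Real.log p / L) *
          (if 0 < logDefect L S - Real.log p / L then 1 else 0) ≤
      ∑ S ∈ P.powerset, (∏ p ∈ S, 7 / ((p : ℝ) - 7)) * (if 0 < logDefect L S then
        0 * logDefect L S ^ 2 + 7 * logDefect L S + C / L else 0) := by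
    refine Finset.sum_le_sum fun S hS => mul_le_mul_of_nonneg_left ?_ (hS0 S hS)
    split_ifs with hs
    · refine le_trans ?_ ((hC L hL _ hs (logDefect_le_one hL0 S) P hP).1.trans (by linarith))
      rw [Finset.sum_filter]
      refine Finset.sum_le_sum fun p hp => ?_
      split_ifs with h1 h2 h2
      · rw [mul_one]
      · linarith
      · rw [mul_zero]
        exact mul_nonneg (hh p hp) (hu p)
      · rw [mul_zero]
    · refine Finset.sum_nonpos fun p _ => ?_
      rw [if_neg (by linarith [hu p]), mul_zero]
  have b1 : ∑ S ∈ P.powerset, (∏ p ∈ S, 7 / ((p : ℝ) - 7)) *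
        ∑ p ∈ P, 7 / ((p : ℝ) - 7) * (Real.log p / L) *
          max 0 (logDefect L S - Real.log p / L) ≤
      ∑ S ∈ P.powerset, (∏ p ∈ S, 7 / ((p : ℝ) - 7)) * (if 0 < logDefect L S then
        7 / 2 * logDefect L S ^ 2 + 0 * logDefect L S + C / L else 0) := by
    refine Finset.sum_le_sum fun S hS => mul_le_mul_of_nonneg_left ?_ (hS0 S hS)
    split_ifs with hs
    · refine le_trans ?_ ((hC L hL _ hs (logDefect_le_one hL0 S) P hP).2.trans (by linarith))
      rw [Finset.sum_filter]
      refine Finset.sum_le_sum fun p hp => ?_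
      split_ifs with h1
      · rw [max_eq_right (by linarith)]
      · rw [max_eq_left (by linarith), mul_zero]
    · refine Finset.sum_nonpos fun p _ => ?_
      rw [max_eq_left (by linarith [hu p]), mul_zero]
  have l0 : ∑ S ∈ P.powerset, (∏ p ∈ S, 7 / ((p : ℝ) - 7)) *
      (if 0 < logDefect L S then 1 else 0) * (1 - logDefect L S) =
      selbergMass (fun p => 7 / ((p : ℝ) - 7)) L P -
        ∑ S ∈ P.powerset, (∏ p ∈ S, 7 / ((p : ℝ) - 7)) * max 0 (logDefect L S) := by
    rw [selbergMass, ← Finset.sum_sub_distrib]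
    refine Finset.sum_congr rfl fun S _ => ?_
    split_ifs with hs
    · rw [max_eq_right hs.le]; ring
    · rw [max_eq_left (not_lt.1 hs)]; ring
  have l1 : ∑ S ∈ P.powerset, (∏ p ∈ S, 7 / ((p : ℝ) - 7)) *
      max 0 (logDefect L S) * (1 - logDefect L S) =
      ∑ S ∈ P.powerset, (∏ p ∈ S, 7 / ((p : ℝ) - 7)) * max 0 (logDefect L S) -
        ∑ S ∈ P.powerset, (∏ p ∈ S, 7 / ((p : ℝ) - 7)) * max 0 (logDefect L S) ^ 2 := by
    rw [← Finset.sum_sub_distrib]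
    refine Finset.sum_congr rfl fun S _ => ?_
    rcases le_total 0 (logDefect L S) with hs | hs
    · rw [max_eq_right hs]; ring
    · rw [max_eq_left hs]; ring
  rw [l0] at k0
  rw [l1] at k1
  constructor <;> linarith

/-- The main term of the weighted sieve of dimension seven is bounded below. -/
theorem exists_selbergMass_le_main_term :
    ∃ L₀ : ℝ, 1 ≤ L₀ ∧ ∀ L : ℝ, L₀ ≤ L →
      ∀ P : Finset ℕ, (∀ p ∈ P, p.Prime ∧ 14 ≤ p ∧ Real.log p ≤ 2 * L) →
        0.01 * selbergMass (fun p => 7 / ((p : ℝ) - 7)) L P ≤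
          13.6 * ∑ S ∈ P.powerset, (∏ p ∈ S, 7 / ((p : ℝ) - 7)) * max 0 (logDefect L S) ^ 2 -
          ∑ p ∈ P, (1 - Real.log p / L / 2 + if Real.log p / L ≤ 0.00001 then 13.6 else 0) *
            (7 / (p : ℝ) * ∑ S ∈ (P.erase p).powerset, (∏ q ∈ S, 7 / ((q : ℝ) - 7)) *
              (max 0 (logDefect L S) - max 0 (logDefect L (insert p S))) ^ 2) := by
  obtain ⟨C₁, hC₁, h₁⟩ := exists_selbergMass_le_moments
  obtain ⟨C₂, hC₂, h₂⟩ := exists_sum_weight_mul_min_sq_le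
  refine ⟨1 + 1000000 * (C₁ + C₂), by linarith [add_pos hC₁ hC₂], fun L hL P hP => ?_⟩
  have hL1 : 1 ≤ L := by linarith [add_pos hC₁ hC₂]
  have hL0 : 0 < L := by linarith
  have hCL₁ : C₁ / L ≤ 0.000001 := by rw [div_le_iff₀ hL0]; linarith
  have hCL₂ : C₂ / L ≤ 0.000001 := by rw [div_le_iff₀ hL0]; linarith
  have hh : ∀ p ∈ P, (0 : ℝ) ≤ 7 / ((p : ℝ) - 7) := fun p hp =>
    seven_div_sub_seven_nonneg (hP p hp).2.1
  have hu : ∀ p : ℕ, 0 ≤ Real.log p / L := fun p => div_nonneg (Real.log_natCast_nonneg p) hL0.le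
  have hS0 : ∀ S ∈ P.powerset, (0 : ℝ) ≤ ∏ p ∈ S, 7 / ((p : ℝ) - 7) := fun S hS =>
    Finset.prod_nonneg fun p hp => hh p (Finset.mem_powerset.1 hS hp)
  have hc : ∀ p ∈ P, 0 ≤ (1 - Real.log p / L / 2 +
      if Real.log p / L ≤ 0.00001 then (13.6 : ℝ) else 0) := by
    intro p hp
    have : Real.log p / L ≤ 2 := by
      rw [div_le_iff₀ hL0]; exact (hP p hp).2.2
    split_ifs <;> linarith
  have bound : ∑ p ∈ P, (1 - Real.log p / L / 2 +
        if Real.log p / L ≤ 0.00001 then (13.6 : ℝ) else 0) *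
        (7 / (p : ℝ) * ∑ S ∈ (P.erase p).powerset, (∏ q ∈ S, 7 / ((q : ℝ) - 7)) *
          (max 0 (logDefect L S) - max 0 (logDefect L (insert p S))) ^ 2) ≤
      ∑ S ∈ P.powerset, (∏ p ∈ S, 7 / ((p : ℝ) - 7)) * (if 0 < logDefect L S then
        7 * 0.9432 * logDefect L S ^ 2 + 7 * 0.2 * logDefect L S +
          (7 * 13.6 * 0.00001 + C₂ * (1 + 13.6) / L) else 0) := by
    calc _ ≤ ∑ p ∈ P, ∑ S ∈ P.powerset, (∏ q ∈ S, 7 / ((q : ℝ) - 7)) *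
          ((if 0 < logDefect L S then (1 - Real.log p / L / 2 +
          if Real.log p / L ≤ 0.00001 then (13.6 : ℝ) else 0) *
          (7 / (p : ℝ) * min (Real.log p / L) (logDefect L S) ^ 2) else 0)) := by
          refine Finset.sum_le_sum fun p hp => ?_
          rw [Finset.mul_sum, Finset.mul_sum]
          have hterm : ∀ S ∈ P.powerset, 0 ≤ (if 0 < logDefect L S then (1 - Real.log p / L / 2 +
              if Real.log p / L ≤ 0.00001 then (13.6 : ℝ) else 0) *
              (7 / (p : ℝ) * min (Real.log p / L) (logDefect L S) ^ 2) else 0) := fun S _ => by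
            by_cases hs : 0 < logDefect L S
            · rw [if_pos hs]
              exact mul_nonneg (hc p hp) (by positivity)
            · rw [if_neg hs]
          refine le_trans (Finset.sum_le_sum fun S hS => ?_)
            (Finset.sum_le_sum_of_subset_of_nonneg
              (Finset.powerset_mono.2 (Finset.erase_subset p P))
              fun S hS _ => mul_nonneg (hS0 S hS) (hterm S hS))
          have hpS : p ∉ S := fun h => Finset.notMem_erase p P (Finset.mem_powerset.1 hS h)
          rw [logDefect_insert L hpS]
          by_cases hs : 0 < logDefect L S
          · rw [if_pos hs, max_eq_right hs.le]
            have : logDefect L S - max 0 (logDefect L S - Real.log p / L) =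
                min (Real.log p / L) (logDefect L S) := by
              rcases le_total (Real.log p / L) (logDefect L S) with h | h
              · rw [min_eq_left h, max_eq_right (by linarith)]; ring
              · rw [min_eq_right h, max_eq_left (by linarith)]; ring
            rw [this]
            apply le_of_eq
            ring
          · rw [if_neg hs, max_eq_left (not_lt.1 hs), max_eq_left (by linarith [hu p])]
            simp
      _ = ∑ S ∈ P.powerset, (∏ q ∈ S, 7 / ((q : ℝ) - 7)) * ∑ p ∈ P,
          ((if 0 < logDefect L S then (1 - Real.log p / L / 2 +
          if Real.log p / L ≤ 0.00001 then (13.6 : ℝ) else 0) *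
          (7 / (p : ℝ) * min (Real.log p / L) (logDefect L S) ^ 2) else 0)) := by
          rw [Finset.sum_comm]
          simp_rw [Finset.mul_sum]
      _ ≤ _ := by
          refine Finset.sum_le_sum fun S hS => mul_le_mul_of_nonneg_left ?_ (hS0 S hS)
          by_cases hs : 0 < logDefect L S
          · simp only [if_pos hs]
            have := h₂ L hL1 _ hs (logDefect_le_one hL0 S) 0.00001 (by norm_num) 13.6 (by norm_num)
              P (fun p hp => ⟨(hP p hp).1, (hP p hp).2.2⟩)
            linarith
          · simp only [if_neg hs, Finset.sum_const_zero, le_refl]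
  rw [sum_ite_logDefect_mul_add] at bound
  obtain ⟨m0, m1⟩ := h₁ L hL1 P fun p hp => ⟨(hP p hp).1, (hP p hp).2.1⟩
  have hM : 0 ≤ selbergMass (fun p => 7 / ((p : ℝ) - 7)) L P :=
    zero_le_one.trans (one_le_selbergMass hh L)
  have i1 := mul_le_mul_of_nonneg_right hCL₁ hM
  have i2 := mul_le_mul_of_nonneg_right hCL₂ hM
  have e2 : C₂ * (1 + 13.6) / L = 14.6 * (C₂ / L) := by ring
  rw [e2] at bound
  linarith

theorem exists_dvd_mul_add_iff_modEq {a q : ℕ} (b : ℕ) (hq : 0 < q) (h : q.Coprime a) :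
    ∃ k, ∀ m, q ∣ a * m + b ↔ m ≡ k [MOD q] := by
  obtain ⟨k, hk⟩ : ∃ k, q ∣ a * k + b := by
    have : NeZero q := ⟨hq.ne'⟩
    refine ⟨((-(b : ZMod q)) * (ZMod.unitOfCoprime a h.symm)⁻¹.val).val, ?_⟩
    rw [← ZMod.natCast_eq_zero_iff]
    push_cast
    rw [ZMod.natCast_zmod_val]
    have : ((ZMod.unitOfCoprime a h.symm : (ZMod q)ˣ) : ZMod q) *
        ((ZMod.unitOfCoprime a h.symm)⁻¹ : (ZMod q)ˣ) = 1 := Units.mul_inv _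
    rw [ZMod.coe_unitOfCoprime] at this
    linear_combination (-(b : ZMod q)) * this
  refine ⟨k, fun m => ?_⟩
  rw [← Nat.modEq_zero_iff_dvd]
  rw [← Nat.modEq_zero_iff_dvd] at hk
  constructor
  · intro hm
    exact ((hm.trans hk.symm).add_right_cancel' b).cancel_left_of_coprime h
  · intro hm
    exact ((hm.mul_left a).add_right b).trans hk

theorem abs_card_filter_modEq_sub_le {q : ℕ} (hq : 0 < q) (X k : ℕ) :
    |(((Finset.range X).filter fun m => m ≡ k [MOD q]).card : ℝ) - (X : ℝ) / q| ≤ 1 := by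
  rw [← Nat.count_eq_card_filter_range, Nat.count_modEq_card _ hq]
  have h := Nat.div_add_mod X q
  have h2 := Nat.mod_lt X hq
  have hq' : (0 : ℝ) < q := by exact_mod_cast hq
  have e : (X : ℝ) / q = (X / q : ℕ) + (X % q : ℕ) / (q : ℝ) := by
    field_simp
    exact_mod_cast h.symm
  have h3 : 0 ≤ ((X % q : ℕ) : ℝ) / q := by positivity
  have h4 : ((X % q : ℕ) : ℝ) / q ≤ 1 := by
    rw [div_le_one hq']
    exact_mod_cast h2.le
  rw [e, abs_le]
  push_cast
  split_ifs <;> constructor <;> linarith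

/-- The number of zeros of a product of seven coprime linear forms modulo a set of primes, in a
residue class. -/
theorem abs_card_filter_forall_dvd_sub_le {α β : Fin 7 → ℕ} {D : Finset ℕ}
    (hD : ∀ p ∈ D, p.Prime ∧ ∀ i, ¬ p ∣ α i)
    (hαβ : ∀ p : ℕ, p.Prime → ∀ i j, i ≠ j → ∀ m,
      p ∣ α i * m + β i → ¬ p ∣ α j * m + β j) (X : ℕ) :
    ∀ q k : ℕ, 0 < q → (∀ p ∈ D, q.Coprime p) →
      |(((Finset.range X).filter fun m => m ≡ k [MOD q] ∧
        ∀ p ∈ D, p ∣ ∏ i, (α i * m + β i)).card : ℝ) - (X : ℝ) / q * ∏ p ∈ D, 7 / (p : ℝ)| ≤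
        7 ^ D.card := by
  induction D using Finset.induction_on with
  | empty =>
    intro q k hq _
    simpa using abs_card_filter_modEq_sub_le hq X k
  | insert p D hpD ih =>
    intro q k hq hco
    obtain ⟨hp, hpα⟩ := hD p (Finset.mem_insert_self p D)
    have hqp : q.Coprime p := hco p (Finset.mem_insert_self p D)
    choose r hr using fun i => exists_dvd_mul_add_iff_modEq (β i) hp.pos
      ((Nat.Prime.coprime_iff_not_dvd hp).2 (hpα i))
    have hc : ∀ i, ∃ c, ∀ m, m ≡ c [MOD q * p] ↔ m ≡ k [MOD q] ∧ m ≡ r i [MOD p] := fun i => by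
      obtain ⟨c, hc1, hc2⟩ := Nat.chineseRemainder hqp k (r i)
      refine ⟨c, fun m => ?_⟩
      rw [← Nat.modEq_and_modEq_iff_modEq_mul hqp]
      exact ⟨fun h => ⟨h.1.trans hc1, h.2.trans hc2⟩,
        fun h => ⟨h.1.trans hc1.symm, h.2.trans hc2.symm⟩⟩
    choose c hc using hc
    have hsplit : ((Finset.range X).filter fun m => m ≡ k [MOD q] ∧
        ∀ p' ∈ insert p D, p' ∣ ∏ i, (α i * m + β i)) =
        Finset.univ.biUnion fun i => (Finset.range X).filter fun m => m ≡ c i [MOD q * p] ∧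
          ∀ p' ∈ D, p' ∣ ∏ i, (α i * m + β i) := by
      ext m
      simp only [Finset.mem_filter, Finset.mem_biUnion, Finset.mem_univ, true_and, hc,
        Finset.forall_mem_insert, hp.prime.dvd_finsetProd_iff, ← hr]
      tauto
    have hcard : (((Finset.range X).filter fun m => m ≡ k [MOD q] ∧
        ∀ p' ∈ insert p D, p' ∣ ∏ i, (α i * m + β i)).card : ℝ) =
        ∑ i, (((Finset.range X).filter fun m => m ≡ c i [MOD q * p] ∧
          ∀ p' ∈ D, p' ∣ ∏ i, (α i * m + β i)).card : ℝ) := by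
      rw [hsplit, Finset.card_biUnion, Nat.cast_sum]
      intro i _ j _ hij
      rw [Function.onFun, Finset.disjoint_left]
      intro m hi hj
      rw [Finset.mem_filter, hc] at hi hj
      exact hαβ p hp i j hij m ((hr i m).2 hi.2.1.2) ((hr j m).2 hj.2.1.2)
    have hcop : ∀ p' ∈ D, (q * p).Coprime p' := fun p' hp' =>
      Nat.Coprime.mul_left (hco p' (Finset.mem_insert_of_mem hp'))
        ((Nat.coprime_primes hp (hD p' (Finset.mem_insert_of_mem hp')).1).2
          fun h => hpD (h ▸ hp'))
    have ih' := fun i => ih (fun p' hp' => hD p' (Finset.mem_insert_of_mem hp')) (q * p) (c i)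
      (Nat.mul_pos hq hp.pos) hcop
    have e : (X : ℝ) / q * ∏ p' ∈ insert p D, 7 / (p' : ℝ) =
        ∑ _i : Fin 7, (X : ℝ) / (q * p : ℕ) * ∏ p' ∈ D, 7 / (p' : ℝ) := by
      rw [Finset.prod_insert hpD, Finset.sum_const, Finset.card_univ, Fintype.card_fin,
        nsmul_eq_mul]
      push_cast
      have : (p : ℝ) ≠ 0 := by exact_mod_cast hp.ne_zero
      have : (q : ℝ) ≠ 0 := by exact_mod_cast hq.ne'
      field_simp
    rw [hcard, e, ← Finset.sum_sub_distrib, Finset.card_insert_of_notMem hpD]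
    refine (Finset.abs_sum_le_sum_abs _ _).trans ((Finset.sum_le_sum fun i _ => ih' i).trans ?_)
    rw [Finset.sum_const, Finset.card_univ, Fintype.card_fin, nsmul_eq_mul, pow_succ]
    push_cast
    linarith

theorem abs_card_filter_range_forall_dvd_sub_le {α β : Fin 7 → ℕ} {D : Finset ℕ}
    (hD : ∀ p ∈ D, p.Prime ∧ ∀ i, ¬ p ∣ α i)
    (hαβ : ∀ p : ℕ, p.Prime → ∀ i j, i ≠ j → ∀ m,
      p ∣ α i * m + β i → ¬ p ∣ α j * m + β j) (X : ℕ) :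
    |(((Finset.range X).filter fun m => ∀ p ∈ D, p ∣ ∏ i, (α i * m + β i)).card : ℝ) -
      X * ∏ p ∈ D, 7 / (p : ℝ)| ≤ 7 ^ D.card := by
  have := abs_card_filter_forall_dvd_sub_le hD hαβ X 1 0 one_pos fun p _ => Nat.coprime_one_left p
  simpa [Nat.modEq_one] using this

theorem card_filter_sq_dvd_le {a b p : ℕ} (hp : p.Prime) (ha : ¬ p ∣ a) (X : ℕ) :
    (((Finset.range X).filter fun m => p ^ 2 ∣ a * m + b).card : ℝ) ≤ X / (p : ℝ) ^ 2 + 1 := by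
  obtain ⟨k, hk⟩ := exists_dvd_mul_add_iff_modEq b (pow_pos hp.pos 2)
    (Nat.Coprime.pow_left 2 ((Nat.Prime.coprime_iff_not_dvd hp).2 ha))
  simp_rw [hk]
  have := (abs_le.1 (abs_card_filter_modEq_sub_le (pow_pos hp.pos 2) X k)).2
  push_cast at this
  linarith

theorem logDefect_anti {L : ℝ} (hL : 0 < L) {D S : Finset ℕ} (h : D ⊆ S) :
    logDefect L S ≤ logDefect L D := by
  rw [logDefect, logDefect]
  refine sub_le_sub_left (Finset.sum_le_sum_of_subset_of_nonneg h fun p _ _ => ?_) 1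
  exact div_nonneg (Real.log_natCast_nonneg p) hL.le

/-- The coefficients of the Selberg sieve of dimension seven and level `exp L`. -/
noncomputable def sevenSieveCoeff (L : ℝ) (P D : Finset ℕ) : ℝ :=
  selbergCoeff (fun p => 7 / (p : ℝ)) (fun p => 7 / ((p : ℝ) - 7))
    (fun S => max 0 (logDefect L S)) P D

theorem abs_sevenSieveCoeff_le {L : ℝ} (hL : 0 < L) {P D : Finset ℕ}
    (hP : ∀ p ∈ P, 14 ≤ p) (hD : D ⊆ P) :
    |sevenSieveCoeff L P D| ≤
      if 0 < logDefect L D then 2 ^ D.card * selbergMass (fun p => 7 / ((p : ℝ) - 7)) L P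
      else 0 := by
  have hh : ∀ p ∈ P, (0 : ℝ) ≤ 7 / ((p : ℝ) - 7) := fun p hp => seven_div_sub_seven_nonneg (hP p hp)
  have hS0 : ∀ S, S ⊆ P → (0 : ℝ) ≤ ∏ p ∈ S, 7 / ((p : ℝ) - 7) := fun S hS =>
    Finset.prod_nonneg fun p hp => hh p (hS hp)
  have hg0 : 0 ≤ (∏ p ∈ D, 7 / (p : ℝ))⁻¹ := by positivity
  rw [sevenSieveCoeff, selbergCoeff, abs_mul, abs_mul, abs_pow, abs_neg, abs_one, one_pow, one_mul,
    abs_of_nonneg hg0, abs_of_nonneg (Finset.sum_nonneg fun S hS => by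
      split_ifs
      · exact mul_nonneg (hS0 S (Finset.mem_powerset.1 hS)) (le_max_left _ _)
      · exact le_rfl)]
  split_ifs with hs
  · have hsum : ∑ S ∈ P.powerset, (if D ⊆ S then (∏ p ∈ S, 7 / ((p : ℝ) - 7)) *
        max 0 (logDefect L S) else 0) ≤
        (∏ p ∈ D, 7 / ((p : ℝ) - 7)) * selbergMass (fun p => 7 / ((p : ℝ) - 7)) L P := by
      rw [← Finset.sum_filter, selbergMass, Finset.mul_sum]
      calc _ ≤ ∑ S ∈ P.powerset.filter (fun S => D ⊆ S), (∏ p ∈ D, 7 / ((p : ℝ) - 7)) *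
            (if 0 < logDefect L (S \ D) then ∏ p ∈ S \ D, 7 / ((p : ℝ) - 7) else 0) := by
            refine Finset.sum_le_sum fun S hS => ?_
            rw [Finset.mem_filter, Finset.mem_powerset] at hS
            have h1 := logDefect_anti hL (Finset.sdiff_subset (s := S) (t := D))
            have h3 := hS0 S hS.1
            have h2 : (∏ p ∈ D, 7 / ((p : ℝ) - 7)) * ∏ p ∈ S \ D, 7 / ((p : ℝ) - 7) =
                ∏ p ∈ S, 7 / ((p : ℝ) - 7) := by
              rw [mul_comm]; exact Finset.prod_sdiff hS.2
            rw [mul_ite, mul_zero, h2]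
            split_ifs with h
            · exact mul_le_of_le_one_right h3 (max_le zero_le_one (logDefect_le_one hL S))
            · rw [max_eq_left (by linarith), mul_zero]
        _ = ∑ T ∈ (P.powerset.filter (fun S => D ⊆ S)).image (fun S => S \ D),
            (∏ p ∈ D, 7 / ((p : ℝ) - 7)) *
            (if 0 < logDefect L T then ∏ p ∈ T, 7 / ((p : ℝ) - 7) else 0) := by
            rw [Finset.sum_image]
            intro S hS T hT hST
            rw [Finset.mem_coe, Finset.mem_filter] at hS hT
            simp only at hST
            rw [← Finset.sdiff_union_of_subset hS.2, hST, Finset.sdiff_union_of_subset hT.2]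
        _ ≤ _ := by
            refine Finset.sum_le_sum_of_subset_of_nonneg (fun T hT => ?_) fun T hT _ => ?_
            · rw [Finset.mem_image] at hT
              obtain ⟨S, hS, rfl⟩ := hT
              rw [Finset.mem_filter, Finset.mem_powerset] at hS
              exact Finset.mem_powerset.2 (Finset.sdiff_subset.trans hS.1)
            · refine mul_nonneg (hS0 D hD) ?_
              split_ifs
              · exact hS0 T (Finset.mem_powerset.1 hT)
              · exact le_rfl
    have hM := zero_le_one.trans (one_le_selbergMass hh L)
    refine (mul_le_mul_of_nonneg_left hsum hg0).trans ?_
    rw [← mul_assoc, ← Finset.prod_inv_distrib, ← Finset.prod_mul_distrib]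
    refine mul_le_mul_of_nonneg_right ?_ hM
    rw [← Finset.prod_const]
    refine Finset.prod_le_prod (fun p hp => mul_nonneg (by positivity) (hh p (hD hp)))
      fun p hp => ?_
    have : (14 : ℝ) ≤ p := by exact_mod_cast hP p (hD hp)
    rw [inv_div, div_mul_div_comm, div_le_iff₀ (by nlinarith)]
    nlinarith
  · rw [Finset.sum_eq_zero fun S hS => ?_, mul_zero]
    split_ifs with h
    · rw [max_eq_left ((logDefect_anti hL h).trans (not_lt.1 hs)), mul_zero]
    · rfl

theorem sum_abs_sevenSieveCoeff_mul_le {L : ℝ} (hL : 0 < L) {P : Finset ℕ}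
    (hP : ∀ p ∈ P, p.Prime ∧ 7 ^ 100 ≤ p) :
    ∑ D ∈ P.powerset, |sevenSieveCoeff L P D| * 7 ^ D.card ≤
      Real.exp (1.02 * L) * selbergMass (fun p => 7 / ((p : ℝ) - 7)) L P := by
  have h14 : ∀ p ∈ P, 14 ≤ p := fun p hp => le_trans (by norm_num) (hP p hp).2
  have hh : ∀ p ∈ P, (0 : ℝ) ≤ 7 / ((p : ℝ) - 7) := fun p hp => seven_div_sub_seven_nonneg (h14 p hp)
  set M := selbergMass (fun p => 7 / ((p : ℝ) - 7)) L P with hMdef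
  have hM : 0 ≤ M := zero_le_one.trans (one_le_selbergMass hh L)
  have hlogprod : ∀ D ∈ P.powerset, Real.log (∏ p ∈ D, p : ℕ) = ∑ p ∈ D, Real.log p := by
    intro D hD
    push_cast
    refine Real.log_prod fun p hp => ?_
    exact_mod_cast (hP p (Finset.mem_powerset.1 hD hp)).1.ne_zero
  have hsupp : ∀ D ∈ P.powerset, 0 < logDefect L D → ∑ p ∈ D, Real.log p < L := by
    intro D _ hD
    rw [logDefect, ← Finset.sum_div, sub_pos, div_lt_one hL] at hD
    exact hD
  calc _ ≤ ∑ D ∈ P.powerset.filter (fun D => 0 < logDefect L D), Real.exp (0.02 * L) * M := by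
        rw [Finset.sum_filter]
        refine Finset.sum_le_sum fun D hD => ?_
        have h1 := abs_sevenSieveCoeff_le hL h14 (Finset.mem_powerset.1 hD)
        refine (mul_le_mul_of_nonneg_right h1 (by positivity)).trans ?_
        split_ifs with hs
        · rw [mul_right_comm, ← mul_pow]
          refine mul_le_mul_of_nonneg_right ?_ hM
          have h2 : ∀ p ∈ D, Real.log 14 ≤ 0.02 * Real.log p := by
            intro p hp
            have h7 : (7 : ℝ) ^ 100 ≤ p := by
              exact_mod_cast (hP p (Finset.mem_powerset.1 hD hp)).2
            have h3 := Real.log_le_log (by positivity) h7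
            have h4 : Real.log 14 ≤ Real.log (7 ^ 2) := Real.log_le_log (by norm_num) (by norm_num)
            rw [Real.log_pow] at h3 h4
            push_cast at h3 h4
            linarith
          have h3 := Finset.sum_le_sum h2
          rw [Finset.sum_const, nsmul_eq_mul, ← Finset.mul_sum] at h3
          have h4 := hsupp D hD hs
          have e : (2 * 7 : ℝ) ^ D.card = Real.exp (D.card * Real.log 14) := by
            rw [← Real.log_pow, Real.exp_log (by positivity)]
            norm_num
          rw [e, Real.exp_le_exp]
          linarith
        · rw [zero_mul]
    _ = (P.powerset.filter (fun D => 0 < logDefect L D)).card * (Real.exp (0.02 * L) * M) := by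
        rw [Finset.sum_const, nsmul_eq_mul]
    _ ≤ Real.exp L * (Real.exp (0.02 * L) * M) := by
        refine mul_le_mul_of_nonneg_right ?_ (by positivity)
        have hcard : (P.powerset.filter (fun D => 0 < logDefect L D)).card ≤
            (Finset.Icc 1 ⌊Real.exp L⌋₊).card := by
          refine Finset.card_le_card_of_injOn (fun D => ∏ p ∈ D, p) (fun D hD => ?_) ?_
          · rw [Finset.mem_coe, Finset.mem_filter] at hD
            have hpos : 0 < ∏ p ∈ D, p := Finset.prod_pos fun p hp =>
              (hP p (Finset.mem_powerset.1 hD.1 hp)).1.pos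
            rw [Finset.mem_coe, Finset.mem_Icc]
            refine ⟨hpos, Nat.le_floor ?_⟩
            rw [← Real.log_le_iff_le_exp (by exact_mod_cast hpos), hlogprod D hD.1]
            exact (hsupp D hD.1 hD.2).le
          · intro D hD E hE h
            rw [Finset.mem_coe, Finset.mem_filter, Finset.mem_powerset] at hD hE
            simp only at h
            have hF : ∀ D : Finset ℕ, D ⊆ P → (∏ p ∈ D, p).primeFactors = D := fun D hD =>
              Nat.primeFactors_prod fun p hp => (hP p (hD hp)).1
            rw [← hF D hD.1, ← hF E hE.1, h]
        rw [Nat.card_Icc, Nat.add_sub_cancel] at hcard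
        exact (Nat.cast_le.2 hcard).trans (Nat.floor_le (Real.exp_pos L).le)
    _ = _ := by
        rw [← mul_assoc, ← Real.exp_add]
        ring_nf

/-- The sieve weight (before squaring) of an integer. -/
noncomputable def sevenSieveWeight (L : ℝ) (P : Finset ℕ) (n : ℕ) : ℝ :=
  ∑ D ∈ P.powerset, if ∀ p ∈ D, p ∣ n then sevenSieveCoeff L P D else 0

theorem sevenSieveWeight_sq_le {L : ℝ} (hL : 0 < L) {P : Finset ℕ} (hP : ∀ p ∈ P, 14 ≤ p) (n : ℕ) :
    sevenSieveWeight L P n ^ 2 ≤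
      9 ^ (P.filter (fun p => p ∣ n)).card * selbergMass (fun p => 7 / ((p : ℝ) - 7)) L P ^ 2 := by
  have hh : ∀ p ∈ P, (0 : ℝ) ≤ 7 / ((p : ℝ) - 7) := fun p hp => seven_div_sub_seven_nonneg (hP p hp)
  set M := selbergMass (fun p => 7 / ((p : ℝ) - 7)) L P with hMdef
  have hM : 0 ≤ M := zero_le_one.trans (one_le_selbergMass hh L)
  have h1 : |sevenSieveWeight L P n| ≤ 3 ^ (P.filter (fun p => p ∣ n)).card * M := by
    have e : P.powerset.filter (fun D => ∀ p ∈ D, p ∣ n) = (P.filter (fun p => p ∣ n)).powerset := by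
      ext D
      simp only [Finset.mem_filter, Finset.mem_powerset, Finset.subset_iff]
      exact ⟨fun h p hp => ⟨h.1 hp, h.2 p hp⟩, fun h => ⟨fun p hp => (h hp).1, fun p hp => (h hp).2⟩⟩
    rw [sevenSieveWeight, ← Finset.sum_filter, e]
    calc _ ≤ ∑ D ∈ (P.filter (fun p => p ∣ n)).powerset, 2 ^ D.card * M := by
          refine (Finset.abs_sum_le_sum_abs _ _).trans (Finset.sum_le_sum fun D hD => ?_)
          refine (abs_sevenSieveCoeff_le hL hP
            ((Finset.mem_powerset.1 hD).trans (Finset.filter_subset _ _))).trans ?_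
          split_ifs
          · exact le_rfl
          · positivity
      _ = _ := by
          rw [← Finset.sum_mul]
          congr 1
          have := Finset.prod_one_add (f := fun _ : ℕ => (2 : ℝ)) (P.filter (fun p => p ∣ n))
          simp only [Finset.prod_const] at this
          rw [← this]
          norm_num
  calc _ = |sevenSieveWeight L P n| ^ 2 := (sq_abs _).symm
    _ ≤ (3 ^ (P.filter (fun p => p ∣ n)).card * M) ^ 2 := by gcongr
    _ = _ := by
        rw [mul_pow, ← pow_mul, mul_comm _ 2, pow_mul]
        norm_num

theorem sum_sevenSieveWeight_sq_eq (L : ℝ) (P T : Finset ℕ) (F : ℕ → ℕ) (X : ℕ) :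
    ∑ m ∈ Finset.range X, (if ∀ p ∈ T, p ∣ F m then sevenSieveWeight L P (F m) ^ 2 else 0) =
      ∑ D ∈ P.powerset, ∑ E ∈ P.powerset, sevenSieveCoeff L P D * sevenSieveCoeff L P E *
        (((Finset.range X).filter fun m => ∀ p ∈ T ∪ (D ∪ E), p ∣ F m).card : ℝ) := by
  have h1 : ∀ m, (if ∀ p ∈ T, p ∣ F m then sevenSieveWeight L P (F m) ^ 2 else 0) =
      ∑ D ∈ P.powerset, ∑ E ∈ P.powerset, sevenSieveCoeff L P D * sevenSieveCoeff L P E *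
        if ∀ p ∈ T ∪ (D ∪ E), p ∣ F m then 1 else 0 := by
    intro m
    have h2 : ∀ D E : Finset ℕ, (∀ p ∈ T ∪ (D ∪ E), p ∣ F m) ↔
        (∀ p ∈ T, p ∣ F m) ∧ (∀ p ∈ D, p ∣ F m) ∧ ∀ p ∈ E, p ∣ F m := fun D E => by
      simp only [Finset.mem_union, or_imp, forall_and]
    simp only [h2]
    by_cases hT : ∀ p ∈ T, p ∣ F m
    · rw [if_pos hT, sq, sevenSieveWeight, Finset.sum_mul_sum]
      refine Finset.sum_congr rfl fun D _ => Finset.sum_congr rfl fun E _ => ?_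
      simp only [eq_true hT, true_and]
      split_ifs <;> first | (exfalso; tauto) | ring
    · simp [hT]
  rw [Finset.sum_congr rfl fun m _ => h1 m, Finset.sum_comm]
  refine Finset.sum_congr rfl fun D _ => ?_
  rw [Finset.sum_comm]
  refine Finset.sum_congr rfl fun E _ => ?_
  rw [← Finset.mul_sum, Finset.sum_boole]

theorem abs_sum_sevenSieveWeight_sq_sub_le {α β : Fin 7 → ℕ} {L : ℝ} (hL : 0 < L) {P T : Finset ℕ}
    (hP : ∀ p ∈ P, p.Prime ∧ 7 ^ 100 ≤ p ∧ ∀ i, ¬ p ∣ α i) (hT : T ⊆ P)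
    (hαβ : ∀ p : ℕ, p.Prime → ∀ i j, i ≠ j → ∀ m,
      p ∣ α i * m + β i → ¬ p ∣ α j * m + β j) (X : ℕ) :
    |∑ m ∈ Finset.range X, (if ∀ p ∈ T, p ∣ ∏ i, (α i * m + β i) then
        sevenSieveWeight L P (∏ i, (α i * m + β i)) ^ 2 else 0) -
      X * ∑ D ∈ P.powerset, ∑ E ∈ P.powerset, sevenSieveCoeff L P D * sevenSieveCoeff L P E *
        ∏ p ∈ T ∪ (D ∪ E), 7 / (p : ℝ)| ≤
      7 ^ T.card * (Real.exp (1.02 * L) *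
        selbergMass (fun p => 7 / ((p : ℝ) - 7)) L P) ^ 2 := by
  have hsum := sum_abs_sevenSieveCoeff_mul_le hL fun p hp => ⟨(hP p hp).1, (hP p hp).2.1⟩
  rw [sum_sevenSieveWeight_sq_eq L P T fun m => ∏ i, (α i * m + β i)]
  rw [Finset.mul_sum, ← Finset.sum_sub_distrib]
  have h1 : ∀ D ∈ P.powerset, |∑ E ∈ P.powerset, sevenSieveCoeff L P D * sevenSieveCoeff L P E *
        (((Finset.range X).filter fun m => ∀ p ∈ T ∪ (D ∪ E),
          p ∣ ∏ i, (α i * m + β i)).card : ℝ) -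
      X * ∑ E ∈ P.powerset, sevenSieveCoeff L P D * sevenSieveCoeff L P E *
        ∏ p ∈ T ∪ (D ∪ E), 7 / (p : ℝ)| ≤
      ∑ E ∈ P.powerset, 7 ^ T.card * ((|sevenSieveCoeff L P D| * 7 ^ D.card) *
        (|sevenSieveCoeff L P E| * 7 ^ E.card)) := by
    intro D hD
    rw [Finset.mul_sum, ← Finset.sum_sub_distrib]
    refine (Finset.abs_sum_le_sum_abs _ _).trans (Finset.sum_le_sum fun E hE => ?_)
    have hsub : ∀ p ∈ T ∪ (D ∪ E), p ∈ P := fun p hp => by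
      rw [Finset.mem_union, Finset.mem_union] at hp
      rcases hp with h | h | h
      · exact hT h
      · exact Finset.mem_powerset.1 hD h
      · exact Finset.mem_powerset.1 hE h
    have h2 := abs_card_filter_range_forall_dvd_sub_le (D := T ∪ (D ∪ E))
      (fun p hp => ⟨(hP p (hsub p hp)).1, (hP p (hsub p hp)).2.2⟩) hαβ X
    have h3 : (7 : ℝ) ^ (T ∪ (D ∪ E)).card ≤ 7 ^ (T.card + (D.card + E.card)) :=
      pow_le_pow_right₀ (by norm_num) ((Finset.card_union_le _ _).trans
        (Nat.add_le_add_left (Finset.card_union_le _ _) _))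
    have e : sevenSieveCoeff L P D * sevenSieveCoeff L P E *
        (((Finset.range X).filter fun m => ∀ p ∈ T ∪ (D ∪ E),
          p ∣ ∏ i, (α i * m + β i)).card : ℝ) -
        X * (sevenSieveCoeff L P D * sevenSieveCoeff L P E * ∏ p ∈ T ∪ (D ∪ E), 7 / (p : ℝ)) =
        sevenSieveCoeff L P D * sevenSieveCoeff L P E *
        ((((Finset.range X).filter fun m => ∀ p ∈ T ∪ (D ∪ E),
          p ∣ ∏ i, (α i * m + β i)).card : ℝ) - X * ∏ p ∈ T ∪ (D ∪ E), 7 / (p : ℝ)) := by ring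
    rw [e, abs_mul, abs_mul]
    refine (mul_le_mul_of_nonneg_left (h2.trans h3) (by positivity)).trans (le_of_eq ?_)
    rw [pow_add, pow_add]
    ring
  refine (Finset.abs_sum_le_sum_abs _ _).trans ((Finset.sum_le_sum h1).trans ?_)
  simp_rw [← Finset.mul_sum]
  rw [← Finset.sum_mul, ← sq]
  have h0 : 0 ≤ ∑ D ∈ P.powerset, |sevenSieveCoeff L P D| * 7 ^ D.card :=
    Finset.sum_nonneg fun D _ => by positivity
  gcongr

/-- The weighted sieve inequality of dimension seven. -/
theorem exists_le_sum_sevenSieveWeight_sq_mul :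
    ∃ L₀ : ℝ, 1 ≤ L₀ ∧ ∀ L : ℝ, L₀ ≤ L → ∀ P : Finset ℕ, ∀ α β : Fin 7 → ℕ,
      (∀ p ∈ P, p.Prime ∧ 7 ^ 100 ≤ p ∧ Real.log p ≤ 2 * L ∧ ∀ i, ¬ p ∣ α i) →
      (∀ p : ℕ, p.Prime → ∀ i j, i ≠ j → ∀ m, p ∣ α i * m + β i → ¬ p ∣ α j * m + β j) →
      ∀ X : ℕ,
        0.01 * X * selbergMass (fun p => 7 / ((p : ℝ) - 7)) L P -
            117 * Real.exp (4.04 * L) * selbergMass (fun p => 7 / ((p : ℝ) - 7)) L P ^ 2 ≤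
          ∑ m ∈ Finset.range X, sevenSieveWeight L P (∏ i, (α i * m + β i)) ^ 2 *
            (13.6 - ∑ p ∈ P.filter (fun p => p ∣ ∏ i, (α i * m + β i)),
              (1 - Real.log p / L / 2 + if Real.log p / L ≤ 0.00001 then 13.6 else 0)) := by
  obtain ⟨L₀, hL₀, hmain⟩ := exists_selbergMass_le_main_term
  refine ⟨L₀, hL₀, fun L hL P α β hP hαβ X => ?_⟩
  have hL1 : 0 < L := by linarith
  have hpos : ∀ p ∈ P, (0 : ℝ) < p := fun p hp => by exact_mod_cast (hP p hp).1.pos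
  have h14 : ∀ p ∈ P, 14 ≤ p := fun p hp => le_trans (by norm_num) (hP p hp).2.1
  have h14' : ∀ p ∈ P, (14 : ℝ) ≤ p := fun p hp => by exact_mod_cast h14 p hp
  have hP' : ∀ p ∈ P, p.Prime ∧ 7 ^ 100 ≤ p ∧ ∀ i, ¬ p ∣ α i := fun p hp =>
    ⟨(hP p hp).1, (hP p hp).2.1, (hP p hp).2.2.2⟩
  have hg : ∀ p ∈ P, (7 : ℝ) / p ≠ 0 := fun p hp => div_ne_zero (by norm_num) (hpos p hp).ne'
  have hh : ∀ p ∈ P, 7 / ((p : ℝ) - 7) ≠ 0 := fun p hp =>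
    div_ne_zero (by norm_num) (by linarith [h14' p hp])
  have hgh : ∀ p ∈ P, (7 / (p : ℝ))⁻¹ = 1 + (7 / ((p : ℝ) - 7))⁻¹ := fun p hp => by
    rw [inv_div, inv_div]
    ring
  have hm := hmain L hL P fun p hp => ⟨(hP p hp).1, h14 p hp, (hP p hp).2.2.1⟩
  set c : ℕ → ℝ := fun p => 1 - Real.log p / L / 2 +
    if Real.log p / L ≤ 0.00001 then 13.6 else 0 with hc
  have hc0 : ∀ p ∈ P, |c p| ≤ 14.6 := by
    intro p hp
    have h1 : Real.log p / L ≤ 2 := by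
      rw [div_le_iff₀ hL1]; exact (hP p hp).2.2.1
    have h2 : 0 ≤ Real.log p / L := div_nonneg (Real.log_natCast_nonneg p) hL1.le
    rw [hc, abs_le]
    dsimp only
    split_ifs <;> constructor <;> linarith
  set F : ℕ → ℕ := fun m => ∏ i, (α i * m + β i) with hF
  set M := selbergMass (fun p => 7 / ((p : ℝ) - 7)) L P with hM
  set K := (Real.exp (1.02 * L) * M) ^ 2 with hK
  have hK0 : 0 ≤ K := sq_nonneg _
  have a0 := abs_sum_sevenSieveWeight_sq_sub_le hL1 hP' (Finset.empty_subset P) hαβ X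
  have a1 := fun p (hp : p ∈ P) => abs_sum_sevenSieveWeight_sq_sub_le hL1 hP'
    (Finset.singleton_subset_iff.2 hp) hαβ X
  have d0 := sum_sum_selbergCoeff_mul (fun S => max 0 (logDefect L S)) hg hh hgh
  have d1 := fun p (hp : p ∈ P) =>
    sum_sum_selbergCoeff_mul_insert (fun S => max 0 (logDefect L S)) hp hg hh hgh
  simp only [Finset.empty_union, Finset.notMem_empty, false_imp_iff, implies_true, if_true,
    Finset.card_empty, pow_zero, one_mul, ← hM, ← hK] at a0
  simp only [Finset.singleton_union, Finset.mem_singleton, forall_eq, Finset.card_singleton,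
    pow_one, ← hM, ← hK] at a1
  simp only [sevenSieveCoeff] at a0 a1
  rw [d0] at a0
  have a1' : ∀ p ∈ P, c p * ∑ m ∈ Finset.range X,
      (if p ∣ F m then sevenSieveWeight L P (F m) ^ 2 else 0) ≤
      X * (c p * (7 / (p : ℝ) * ∑ S ∈ (P.erase p).powerset, (∏ q ∈ S, 7 / ((q : ℝ) - 7)) *
        (max 0 (logDefect L S) - max 0 (logDefect L (insert p S))) ^ 2)) + 14.6 * (7 * K) := by
    intro p hp
    have h1 := a1 p hp
    rw [d1 p hp] at h1
    have h2 := (le_abs_self _).trans ((abs_mul (c p) _).le.trans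
      (mul_le_mul (hc0 p hp) h1 (abs_nonneg _) (by norm_num)))
    rw [mul_sub] at h2
    linarith
  have e : ∑ m ∈ Finset.range X, sevenSieveWeight L P (F m) ^ 2 *
      (13.6 - ∑ p ∈ P.filter (fun p => p ∣ F m), c p) =
      13.6 * ∑ m ∈ Finset.range X, sevenSieveWeight L P (F m) ^ 2 -
      ∑ p ∈ P, c p * ∑ m ∈ Finset.range X,
        (if p ∣ F m then sevenSieveWeight L P (F m) ^ 2 else 0) := by
    simp_rw [Finset.mul_sum]
    rw [Finset.sum_comm (s := P), ← Finset.sum_sub_distrib]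
    refine Finset.sum_congr rfl fun m _ => ?_
    rw [mul_sub, Finset.sum_filter, Finset.mul_sum, mul_comm]
    congr 1
    refine Finset.sum_congr rfl fun p _ => ?_
    split_ifs <;> ring
  have hcard : (P.card : ℝ) ≤ Real.exp (2 * L) := by
    have h1 : P.card ≤ (Finset.Icc 1 ⌊Real.exp (2 * L)⌋₊).card := by
      refine Finset.card_le_card fun p hp => ?_
      rw [Finset.mem_Icc]
      refine ⟨(hP p hp).1.pos, Nat.le_floor ?_⟩
      rw [← Real.log_le_iff_le_exp (hpos p hp)]
      exact (hP p hp).2.2.1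
    rw [Nat.card_Icc, Nat.add_sub_cancel] at h1
    exact (Nat.cast_le.2 h1).trans (Nat.floor_le (Real.exp_pos _).le)
  have hK' : Real.exp (2 * L) * K = Real.exp (4.04 * L) * M ^ 2 := by
    rw [hK, mul_pow, ← mul_assoc, ← Real.exp_nat_mul, ← Real.exp_add]
    push_cast
    ring_nf
  have hs := Finset.sum_le_sum a1'
  rw [Finset.sum_add_distrib, Finset.sum_const, nsmul_eq_mul, ← Finset.mul_sum] at hs
  have h1 : 1 ≤ Real.exp (2 * L) := Real.one_le_exp (by linarith)
  have i1 := mul_le_mul_of_nonneg_right hcard hK0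
  have i2 := mul_le_mul_of_nonneg_right h1 hK0
  have hm' : 0.01 * M ≤ 13.6 * ∑ S ∈ P.powerset, (∏ p ∈ S, 7 / ((p : ℝ) - 7)) *
      max 0 (logDefect L S) ^ 2 - ∑ p ∈ P, c p * (7 / (p : ℝ) *
        ∑ S ∈ (P.erase p).powerset, (∏ q ∈ S, 7 / ((q : ℝ) - 7)) *
          (max 0 (logDefect L S) - max 0 (logDefect L (insert p S))) ^ 2) := hm
  have i3 := mul_le_mul_of_nonneg_left hm' (Nat.cast_nonneg (α := ℝ) X)
  have i4 : -K ≤ ∑ m ∈ Finset.range X, sevenSieveWeight L P (F m) ^ 2 -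
      X * ∑ S ∈ P.powerset, (∏ p ∈ S, 7 / ((p : ℝ) - 7)) * max 0 (logDefect L S) ^ 2 :=
    (abs_le.1 a0).1
  change _ ≤ ∑ m ∈ Finset.range X, sevenSieveWeight L P (F m) ^ 2 *
      (13.6 - ∑ p ∈ P.filter (fun p => p ∣ F m), c p)
  rw [e]
  rw [mul_sub] at i3
  linarith

theorem exists_selbergMass_le_pow : ∃ C : ℝ, 0 < C ∧ ∀ L : ℝ, 1 ≤ L → ∀ P : Finset ℕ,
    (∀ p ∈ P, p.Prime ∧ 14 ≤ p ∧ Real.log p ≤ 2 * L) →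
    selbergMass (fun p => 7 / ((p : ℝ) - 7)) L P ≤ C * L ^ 7 := by
  obtain ⟨C, -, hC⟩ := exists_sum_seven_div_le
  refine ⟨Real.exp C, Real.exp_pos C, fun L hL P hP => ?_⟩
  refine (selbergMass_le (fun p hp => seven_div_sub_seven_nonneg (hP p hp).2.1) L).trans ?_
  refine (Real.exp_le_exp.2 (hC L hL P hP)).trans (le_of_eq ?_)
  rw [Real.exp_add, mul_comm, mul_comm (7 : ℝ), Real.exp_mul, Real.exp_log (by linarith)]
  norm_num

/-- The multiplier of the weighted sieve: positive only if `n` has no small prime factor in `P` and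
few prime factors in `P` altogether. -/
noncomputable def sieveMultiplier (L : ℝ) (P : Finset ℕ) (n : ℕ) : ℝ :=
  13.6 - ∑ p ∈ P.filter (fun p => p ∣ n),
    (1 - Real.log p / L / 2 + if Real.log p / L ≤ 0.00001 then 13.6 else 0)

section SieveMultiplier

variable {L : ℝ} {P : Finset ℕ} {D₀ n : ℕ}

theorem one_sub_log_div_nonneg (hL : 0 < L) {p : ℕ} (hp : Real.log p ≤ 2 * L) :
    0 ≤ 1 - Real.log p / L / 2 := by
  have h : Real.log p / L ≤ 2 := by rwa [div_le_iff₀ hL]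
  linarith

theorem sieveMultiplier_le (hL : 0 < L) (hP : ∀ p ∈ P, Real.log p ≤ 2 * L) :
    sieveMultiplier L P n ≤ 13.6 := by
  refine sub_le_self _ (Finset.sum_nonneg fun p hp => ?_)
  have h := one_sub_log_div_nonneg hL (hP p (Finset.mem_filter.1 hp).1)
  split_ifs <;> linarith

theorem lt_log_of_sieveMultiplier_pos (hL : 0 < L)
    (hP : ∀ p : ℕ, p ∈ P ↔ p.Prime ∧ D₀ < p ∧ Real.log p ≤ 2 * L)
    (hn : ∀ p : ℕ, p.Prime → p ∣ n → D₀ < p) (h : 0 < sieveMultiplier L P n)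
    {p : ℕ} (hp : p.Prime) (hpn : p ∣ n) : 0.00001 * L < Real.log p := by
  by_contra! hlog
  have hpP : p ∈ P := (hP p).2 ⟨hp, hn p hp hpn, by linarith⟩
  have hu : Real.log p / L ≤ 0.00001 := by rwa [div_le_iff₀ hL]
  have hs := Finset.single_le_sum (s := P.filter (fun p => p ∣ n))
    (f := fun p : ℕ => 1 - Real.log p / L / 2 + if Real.log p / L ≤ 0.00001 then 13.6 else 0)
    (fun q hq => by
      have h := one_sub_log_div_nonneg hL ((hP q).1 (Finset.mem_filter.1 hq).1).2.2
      split_ifs <;> linarith) (Finset.mem_filter.2 ⟨hpP, hpn⟩)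
  rw [if_pos hu] at hs
  rw [sieveMultiplier] at h
  linarith

theorem sum_log_primeFactors_le (hn : n ≠ 0) : ∑ p ∈ n.primeFactors, Real.log p ≤ Real.log n := by
  rw [← Real.log_prod fun p hp => by exact_mod_cast (Nat.prime_of_mem_primeFactors hp).ne_zero]
  have h := Nat.le_of_dvd (Nat.pos_of_ne_zero hn) (Nat.prod_primeFactors_dvd n)
  refine Real.log_le_log ?_ (by rw [← Nat.cast_prod]; exact_mod_cast h)
  exact Finset.prod_pos fun p hp => by exact_mod_cast (Nat.prime_of_mem_primeFactors hp).pos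

theorem card_filter_dvd_mul_le_of_sieveMultiplier_pos (hL : 0 < L) (hn0 : n ≠ 0)
    (hP : ∀ p : ℕ, p ∈ P ↔ p.Prime ∧ D₀ < p ∧ Real.log p ≤ 2 * L)
    (hn : ∀ p : ℕ, p.Prime → p ∣ n → D₀ < p) (h : 0 < sieveMultiplier L P n) :
    (P.filter (fun p => p ∣ n)).card * (0.00001 * L) ≤ Real.log n := by
  have hsub : P.filter (fun p => p ∣ n) ⊆ n.primeFactors := fun p hp => by
    rw [Finset.mem_filter] at hp
    exact Nat.mem_primeFactors.2 ⟨((hP p).1 hp.1).1, hp.2, hn0⟩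
  refine le_trans ?_ (sum_log_primeFactors_le hn0)
  refine (mul_le_mul_of_nonneg_right (Nat.cast_le.2 (Finset.card_le_card hsub))
    (by positivity)).trans ?_
  rw [← nsmul_eq_mul, ← Finset.sum_const]
  refine Finset.sum_le_sum fun p hp => ?_
  rw [Nat.mem_primeFactors] at hp
  exact (lt_log_of_sieveMultiplier_pos hL hP hn h hp.1 hp.2.1).le

theorem length_primeFactorsList_lt_of_sieveMultiplier_pos (hL : 0 < L) (hsq : Squarefree n)
    (hP : ∀ p : ℕ, p ∈ P ↔ p.Prime ∧ D₀ < p ∧ Real.log p ≤ 2 * L)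
    (hn : ∀ p : ℕ, p.Prime → p ∣ n → D₀ < p) (h : 0 < sieveMultiplier L P n) :
    (n.primeFactorsList.length : ℝ) < 13.6 + Real.log n / (2 * L) := by
  have hn0 : n ≠ 0 := hsq.ne_zero
  have hlen : n.primeFactorsList.length = n.primeFactors.card := by
    rw [Nat.primeFactors, List.toFinset_card_of_nodup
      ((Nat.squarefree_iff_nodup_primeFactorsList hn0).1 hsq)]
  have h1 : ∑ p ∈ n.primeFactors, (1 - Real.log p / L / 2) ≤
      ∑ p ∈ P.filter (fun p => p ∣ n),
        (1 - Real.log p / L / 2 + if Real.log p / L ≤ 0.00001 then 13.6 else 0) := by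
    rw [← Finset.sum_filter_add_sum_filter_not _ (fun p => p ∈ P)]
    have h2 : ∑ p ∈ n.primeFactors.filter (fun p => p ∉ P), (1 - Real.log p / L / 2) ≤ 0 := by
      refine Finset.sum_nonpos fun p hp => ?_
      rw [Finset.mem_filter, Nat.mem_primeFactors, hP] at hp
      have h3 : 2 * L < Real.log p := by
        by_contra! h4
        exact hp.2 ⟨hp.1.1, hn p hp.1.1 hp.1.2.1, h4⟩
      have h5 : 2 < Real.log p / L := by rwa [lt_div_iff₀ hL]
      linarith
    have h6 : n.primeFactors.filter (fun p => p ∈ P) = P.filter (fun p => p ∣ n) := by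
      ext p
      simp only [Finset.mem_filter, Nat.mem_primeFactors, hP]
      tauto
    rw [h6]
    have h7 : ∑ p ∈ P.filter (fun p => p ∣ n), (1 - Real.log p / L / 2) ≤
      ∑ p ∈ P.filter (fun p => p ∣ n),
        (1 - Real.log p / L / 2 + if Real.log p / L ≤ 0.00001 then 13.6 else 0) :=
      Finset.sum_le_sum fun p _ => by split_ifs <;> linarith
    linarith
  rw [Finset.sum_sub_distrib, Finset.sum_const, nsmul_eq_mul, mul_one, ← Finset.sum_div,
    ← Finset.sum_div, ← hlen] at h1
  have h8 := sum_log_primeFactors_le hn0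
  have h9 : (∑ p ∈ n.primeFactors, Real.log p) / L / 2 ≤ Real.log n / (2 * L) := by
    rw [div_div, mul_comm L]
    gcongr
  rw [sieveMultiplier] at h
  linarith

end SieveMultiplier

open Classical in
theorem card_filter_exists_sq_dvd_le {α β : Fin 7 → ℕ} {A k X : ℕ}
    (hA : ∀ i, ∀ m < X, α i * m + β i ≤ A * X) (hβ : ∀ i, 0 < β i)
    (hk : ∀ p : ℕ, p.Prime → k < p → ∀ i, ¬ p ∣ α i) :
    (((Finset.range X).filter fun m => ∃ i, ∃ p : ℕ, p.Prime ∧ k < p ∧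
      p ^ 2 ∣ α i * m + β i).card : ℝ) ≤ 7 * (X * (2 / ((k : ℝ) + 1)) + Real.sqrt (A * X)) := by
  set S := (Finset.Ioo k (Nat.sqrt (A * X) + 1)).filter Nat.Prime with hS
  have hsub : ((Finset.range X).filter fun m => ∃ i, ∃ p : ℕ, p.Prime ∧ k < p ∧
      p ^ 2 ∣ α i * m + β i) ⊆ (Finset.univ : Finset (Fin 7)).biUnion fun i => S.biUnion fun p =>
        (Finset.range X).filter fun m => p ^ 2 ∣ α i * m + β i := by
    intro m hm
    rw [Finset.mem_filter] at hm
    obtain ⟨hm, i, p, hp, hkp, hdvd⟩ := hm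
    simp only [Finset.mem_biUnion, Finset.mem_univ, true_and, Finset.mem_filter, hS,
      Finset.mem_Ioo]
    refine ⟨i, p, ⟨⟨hkp, Nat.lt_succ_of_le (Nat.le_sqrt'.2 ?_)⟩, hp⟩, hm, hdvd⟩
    exact (Nat.le_of_dvd (Nat.add_pos_right _ (hβ i)) hdvd).trans (hA i m (Finset.mem_range.1 hm))
  have h1 : ∀ i : Fin 7, ((S.biUnion fun p =>
      (Finset.range X).filter fun m => p ^ 2 ∣ α i * m + β i).card : ℝ) ≤
      X * (2 / ((k : ℝ) + 1)) + Real.sqrt (A * X) := by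
    intro i
    have h2 : ((S.biUnion fun p =>
      (Finset.range X).filter fun m => p ^ 2 ∣ α i * m + β i).card : ℝ) ≤
        ∑ p ∈ S, (X / (p : ℝ) ^ 2 + 1) := by
      refine (Nat.cast_le.2 Finset.card_biUnion_le).trans ?_
      rw [Nat.cast_sum]
      refine Finset.sum_le_sum fun p hp => ?_
      rw [hS, Finset.mem_filter, Finset.mem_Ioo] at hp
      exact card_filter_sq_dvd_le hp.2 (hk p hp.2 hp.1.1 i) X
    refine h2.trans ?_
    rw [Finset.sum_add_distrib, Finset.sum_const, nsmul_eq_mul, mul_one]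
    refine add_le_add ?_ ?_
    · simp_rw [div_eq_mul_inv]
      rw [← Finset.mul_sum, ← div_eq_mul_inv]
      refine mul_le_mul_of_nonneg_left (le_trans ?_ (sum_Ioo_inv_sq_le k (Nat.sqrt (A * X) + 1)))
        (Nat.cast_nonneg X)
      exact Finset.sum_le_sum_of_subset_of_nonneg (Finset.filter_subset _ _)
        fun p _ _ => by positivity
    · have h3 : S.card ≤ Nat.sqrt (A * X) := by
        refine (Finset.card_filter_le _ _).trans ?_
        rw [Nat.card_Ioo]
        omega
      refine (Nat.cast_le.2 h3).trans ?_
      rw [← Nat.cast_mul]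
      exact Real.nat_sqrt_le_real_sqrt
  refine (Nat.cast_le.2 ((Finset.card_le_card hsub).trans Finset.card_biUnion_le)).trans ?_
  rw [Nat.cast_sum]
  refine (Finset.sum_le_sum fun i _ => h1 i).trans (le_of_eq ?_)
  rw [Finset.sum_const, Finset.card_univ, Fintype.card_fin, nsmul_eq_mul]
  norm_num

theorem exists_finset_mem_iff_prime_log_le (D₀ : ℕ) (t : ℝ) :
    ∃ P : Finset ℕ, ∀ p : ℕ, p ∈ P ↔ p.Prime ∧ D₀ < p ∧ Real.log p ≤ t := by
  refine ⟨(Finset.Icc 1 ⌊Real.exp t⌋₊).filter fun p => p.Prime ∧ D₀ < p, fun p => ?_⟩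
  rw [Finset.mem_filter, Finset.mem_Icc]
  constructor
  · rintro ⟨⟨h1, h2⟩, hp, hD⟩
    refine ⟨hp, hD, ?_⟩
    rw [Real.log_le_iff_le_exp (by exact_mod_cast hp.pos)]
    exact (Nat.le_floor_iff (Real.exp_pos t).le).1 h2
  · rintro ⟨hp, hD, h⟩
    refine ⟨⟨hp.pos, Nat.le_floor ?_⟩, hp, hD⟩
    rwa [← Real.log_le_iff_le_exp (by exact_mod_cast hp.pos)]

theorem eventually_log_pow_seven_le {c b : ℝ} (hc : 0 < c) (hb : 0 < b) :
    ∀ᶠ X : ℕ in Filter.atTop, Real.log X ^ 7 ≤ c * Real.exp (b * Real.log X) := by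
  have h := (isLittleO_pow_exp_pos_mul_atTop 7 hb).bound hc
  filter_upwards [(Real.tendsto_log_atTop.comp tendsto_natCast_atTop_atTop).eventually h]
    with X hX
  simp only [Function.comp_apply, Real.norm_eq_abs, Real.abs_exp] at hX
  exact (le_abs_self _).trans hX

theorem le_card_filter_of_le_sum_mul {X : ℕ} {w g : ℕ → ℝ} {S G W : ℝ}
    (hw0 : ∀ m < X, 0 ≤ w m) (hw : ∀ m < X, 0 < g m → w m ≤ W) (hg : ∀ m < X, g m ≤ G)
    (hG : 0 ≤ G) (h : S ≤ ∑ m ∈ Finset.range X, w m * g m) :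
    S ≤ ((Finset.range X).filter fun m => 0 < g m).card * (W * G) := by
  refine h.trans ?_
  rw [← nsmul_eq_mul, ← Finset.sum_const, Finset.sum_filter]
  refine Finset.sum_le_sum fun m hm => ?_
  have hm := Finset.mem_range.1 hm
  split_ifs with h1
  · exact (mul_le_mul_of_nonneg_left (hg m hm) (hw0 m hm)).trans
      (mul_le_mul_of_nonneg_right (hw m hm h1) hG)
  · exact mul_nonpos_of_nonneg_of_nonpos (hw0 m hm) (not_lt.1 h1)

theorem exists_eventually_le_card_filter_sieveMultiplier_pos {α β : Fin 7 → ℕ} {A D₀ : ℕ}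
    (hβ : ∀ i, 0 < β i) (hA : ∀ i, α i + β i ≤ A) (hD₀ : 7 ^ 100 ≤ D₀)
    (hαβD : ∀ p : ℕ, p.Prime → ∀ i m, p ∣ α i * m + β i → D₀ < p)
    (hαD : ∀ p : ℕ, p.Prime → D₀ < p → ∀ i, ¬ p ∣ α i)
    (hαβ : ∀ p : ℕ, p.Prime → ∀ i j, i ≠ j → ∀ m, p ∣ α i * m + β i → ¬ p ∣ α j * m + β j) :
    ∃ κ : ℝ, 0 < κ ∧ ∀ᶠ X : ℕ in Filter.atTop, ∃ P : Finset ℕ,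
      (∀ p : ℕ, p ∈ P ↔ p.Prime ∧ D₀ < p ∧ Real.log p ≤ 2 * (0.245 * Real.log X)) ∧
      κ * X / Real.log X ^ 7 ≤ (((Finset.range X).filter fun m =>
        0 < sieveMultiplier (0.245 * Real.log X) P (∏ i, (α i * m + β i))).card : ℝ) := by
  obtain ⟨L₀, hL₀, hmain⟩ := exists_le_sum_sevenSieveWeight_sq_mul
  obtain ⟨C, hC, hmass⟩ := exists_selbergMass_le_pow
  obtain ⟨K, hK⟩ := exists_nat_ge (14 / (0.00001 * 0.245) : ℝ)
  refine ⟨0.005 / (13.6 * 9 ^ K * C), by positivity, ?_⟩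
  have hlog : Filter.Tendsto (fun X : ℕ => Real.log X) Filter.atTop Filter.atTop :=
    Real.tendsto_log_atTop.comp tendsto_natCast_atTop_atTop
  filter_upwards [eventually_log_pow_seven_le (c := 0.005 / (117 * C)) (b := 0.0102)
    (by positivity) (by norm_num), hlog.eventually_ge_atTop (L₀ / 0.245),
    Filter.eventually_ge_atTop (A + 1)] with X hX1 hX2 hXA
  obtain ⟨P, hP⟩ := exists_finset_mem_iff_prime_log_le D₀ (2 * (0.245 * Real.log X))
  refine ⟨P, hP, ?_⟩
  set l := Real.log X with hl
  have hX0 : (0 : ℝ) < X := by exact_mod_cast (show 0 < X by omega)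
  have hexp : Real.exp l = X := Real.exp_log hX0
  have hL : L₀ ≤ 0.245 * l := by
    rw [div_le_iff₀ (by norm_num)] at hX2
    linarith
  have hL1 : (0 : ℝ) < 0.245 * l := by linarith
  have hl0 : 0 < l := by linarith
  have hP14 : ∀ p ∈ P, 14 ≤ p := fun p hp =>
    le_trans (by norm_num) (hD₀.trans ((hP p).1 hp).2.1.le)
  have hsum := hmain _ hL P α β (fun p hp => by
    have h := (hP p).1 hp
    exact ⟨h.1, hD₀.trans h.2.1.le, h.2.2, hαD p h.1 h.2.1⟩) hαβ X
  have hM1 : 1 ≤ selbergMass (fun p => 7 / ((p : ℝ) - 7)) (0.245 * l) P :=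
    one_le_selbergMass (fun p hp => seven_div_sub_seven_nonneg (hP14 p hp)) _
  have hM2 : selbergMass (fun p => 7 / ((p : ℝ) - 7)) (0.245 * l) P ≤ C * l ^ 7 := by
    refine (hmass _ (by linarith) P fun p hp =>
      ⟨((hP p).1 hp).1, hP14 p hp, ((hP p).1 hp).2.2⟩).trans ?_
    have : 0.245 * l ≤ l := by linarith
    gcongr
  set M := selbergMass (fun p => 7 / ((p : ℝ) - 7)) (0.245 * l) P with hM
  have hM0 : 0 < M := by linarith
  have hmain2 : 117 * Real.exp (4.04 * (0.245 * l)) * M ≤ 0.005 * X := by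
    have h1 : M ≤ C * (0.005 / (117 * C) * Real.exp (0.0102 * l)) := hM2.trans (by gcongr)
    refine (mul_le_mul_of_nonneg_left h1 (by positivity)).trans (le_of_eq ?_)
    rw [← hexp, show l = 4.04 * (0.245 * l) + 0.0102 * l by ring, Real.exp_add,
      ← show l = 4.04 * (0.245 * l) + 0.0102 * l by ring]
    field_simp
  have hcount := le_card_filter_of_le_sum_mul (X := X)
    (w := fun m => sevenSieveWeight (0.245 * l) P (∏ i, (α i * m + β i)) ^ 2)
    (g := fun m => sieveMultiplier (0.245 * l) P (∏ i, (α i * m + β i)))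
    (S := 0.005 * X * M) (G := 13.6) (W := 9 ^ K * M ^ 2) (fun m _ => sq_nonneg _)
    (fun m hm h => by
      refine (sevenSieveWeight_sq_le hL1 hP14 _).trans ?_
      refine mul_le_mul_of_nonneg_right (pow_le_pow_right₀ (by norm_num) ?_) (sq_nonneg M)
      have hprod0 : ∏ i, (α i * m + β i) ≠ 0 :=
        Finset.prod_ne_zero_iff.2 fun i _ => (Nat.add_pos_right _ (hβ i)).ne'
      have h1 := card_filter_dvd_mul_le_of_sieveMultiplier_pos hL1 hprod0 hP (fun p hp hdvd => by
        obtain ⟨i, -, hi⟩ := (hp.prime.dvd_finsetProd_iff _).1 hdvd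
        exact hαβD p hp i m hi) h
      have h2 : ∏ i, (α i * m + β i) ≤ (X ^ 2) ^ 7 := by
        have h3 : ∏ i, (α i * m + β i) ≤ ∏ _i : Fin 7, X ^ 2 := by
          refine Finset.prod_le_prod' fun i _ => ?_
          have := hA i
          nlinarith
        simpa using h3
      have h4 : Real.log (∏ i, (α i * m + β i) : ℕ) ≤ 14 * l := by
        have h5 := Real.log_le_log (by exact_mod_cast Nat.pos_of_ne_zero hprod0)
          (Nat.cast_le (α := ℝ).2 h2)
        rw [← pow_mul, Nat.cast_pow, Real.log_pow] at h5
        simpa using h5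
      have h6 : (14 : ℝ) ≤ K * (0.00001 * 0.245) := by
        rwa [div_le_iff₀ (by norm_num)] at hK
      have h7 := mul_le_mul_of_nonneg_right h6 hl0.le
      have h8 := h1.trans h4
      by_contra! hlt
      have h9 : (K : ℝ) + 1 ≤ (P.filter (fun p => p ∣ ∏ i, (α i * m + β i))).card := by
        exact_mod_cast hlt
      have h10 := mul_le_mul_of_nonneg_right h9 (show 0 ≤ 0.00001 * (0.245 * l) by positivity)
      linarith)
    (fun m _ => sieveMultiplier_le hL1 fun p hp => ((hP p).1 hp).2.2) (by norm_num)
    (by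
      refine le_trans ?_ hsum
      have := mul_le_mul_of_nonneg_right hmain2 hM0.le
      linarith)
  have h1 : 0.005 * X ≤ (((Finset.range X).filter fun m =>
      0 < sieveMultiplier (0.245 * l) P (∏ i, (α i * m + β i))).card : ℝ) * (13.6 * 9 ^ K * M) := by
    refine le_of_mul_le_mul_right (hcount.trans (le_of_eq ?_)) hM0
    ring
  rw [div_mul_eq_mul_div, div_div, div_le_iff₀ (by positivity)]
  refine h1.trans (mul_le_mul_of_nonneg_left ?_ (Nat.cast_nonneg _))
  rw [mul_assoc _ C]
  gcongr

theorem exists_eventually_le_card_filter_squarefree {α β : Fin 7 → ℕ} {A D₀ : ℕ}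
    (hβ : ∀ i, 0 < β i) (hA : ∀ i, α i + β i ≤ A) (hD₀ : 7 ^ 100 ≤ D₀)
    (hαβD : ∀ p : ℕ, p.Prime → ∀ i m, p ∣ α i * m + β i → D₀ < p)
    (hαD : ∀ p : ℕ, p.Prime → D₀ < p → ∀ i, ¬ p ∣ α i)
    (hαβ : ∀ p : ℕ, p.Prime → ∀ i j, i ≠ j → ∀ m, p ∣ α i * m + β i → ¬ p ∣ α j * m + β j) :
    ∃ δ : ℝ, 0 < δ ∧ ∀ᶠ X : ℕ in Filter.atTop, δ * X / Real.log X ^ 7 ≤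
      (((Finset.range X).filter fun m =>
        (∏ i, (α i * m + β i)).primeFactorsList.length ≤ 27 ∧
        ∀ i, Squarefree (α i * m + β i)).card : ℝ) := by
  classical
  obtain ⟨κ, hκ, hmain⟩ :=
    exists_eventually_le_card_filter_sieveMultiplier_pos hβ hA hD₀ hαβD hαD hαβ
  refine ⟨κ / 2, by positivity, ?_⟩
  have hA0 : 1 ≤ A := le_trans (hβ 0) ((Nat.le_add_left _ _).trans (hA 0))
  have hA1 : (1 : ℝ) ≤ A := by exact_mod_cast hA0
  have hlog : Filter.Tendsto (fun X : ℕ => Real.log X) Filter.atTop Filter.atTop :=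
    Real.tendsto_log_atTop.comp tendsto_natCast_atTop_atTop
  filter_upwards [hmain, eventually_log_pow_seven_le (c := κ / 56) (b := 0.00001 * 0.245)
    (by positivity) (by norm_num), eventually_log_pow_seven_le (c := κ / (28 * A)) (b := 1 / 2)
    (by positivity) (by norm_num), hlog.eventually_ge_atTop (151 * Real.log A),
    hlog.eventually_ge_atTop 1, hlog.eventually_ge_atTop (Real.log (D₀ + 1) / (0.00001 * 0.245)),
    Filter.eventually_ge_atTop 1] with X hX hX1 hX2 hX3 hX4 hX5 hX6
  obtain ⟨P, hP, hcard⟩ := hX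
  set l := Real.log X with hl
  have hX0 : (0 : ℝ) < X := by exact_mod_cast hX6
  have hexp : Real.exp l = X := Real.exp_log hX0
  have hL : (0 : ℝ) < 0.245 * l := by linarith
  have hl7 : 0 < l ^ 7 := by positivity
  set k := ⌊Real.exp (0.00001 * 0.245 * l)⌋₊ with hk
  have hD₀k : D₀ ≤ k := by
    refine Nat.le_floor ?_
    rw [div_le_iff₀ (by norm_num), mul_comm, Real.log_le_iff_le_exp (by positivity)] at hX5
    linarith
  have hkexp : Real.exp (0.00001 * 0.245 * l) ≤ k + 1 := (Nat.lt_floor_add_one _).le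
  have hAX : ∀ i, ∀ m < X, α i * m + β i ≤ A * X := fun i m hm => by
    have := hA i
    nlinarith
  have hbad := card_filter_exists_sq_dvd_le hAX hβ
    fun p hp hkp => hαD p hp (hD₀k.trans_lt hkp)
  have hbad2 : (7 : ℝ) * (X * (2 / ((k : ℝ) + 1)) + Real.sqrt (A * X)) ≤ κ / 2 * X / l ^ 7 := by
    rw [le_div_iff₀ hl7]
    have hk0 : (0 : ℝ) < k + 1 := by positivity
    have i1 : X * (2 / ((k : ℝ) + 1)) * l ^ 7 ≤ κ / 28 * X := by
      rw [mul_div_assoc', div_mul_eq_mul_div, div_le_iff₀ hk0]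
      have i2 : l ^ 7 ≤ κ / 56 * (k + 1) := hX1.trans (by gcongr)
      have i3 := mul_le_mul_of_nonneg_left i2 hX0.le
      linarith
    have i4 : Real.sqrt (A * X) ≤ A * Real.exp (1 / 2 * l) := by
      refine Real.sqrt_le_iff.2 ⟨by positivity, ?_⟩
      rw [mul_pow, ← Real.exp_nat_mul]
      have : ((2 : ℕ) : ℝ) * (1 / 2 * l) = l := by push_cast; ring
      rw [this, hexp]
      gcongr
      nlinarith
    have i5 : Real.sqrt (A * X) * l ^ 7 ≤ κ / 28 * X := by
      refine (mul_le_mul i4 hX2 hl7.le (by positivity)).trans (le_of_eq ?_)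
      rw [← hexp, show Real.exp l = Real.exp (1 / 2 * l) * Real.exp (1 / 2 * l) by
        rw [← Real.exp_add]; ring_nf]
      field_simp
    linarith
  have hsub : ((Finset.range X).filter fun m =>
        0 < sieveMultiplier (0.245 * l) P (∏ i, (α i * m + β i))) ⊆
      ((Finset.range X).filter fun m =>
        (∏ i, (α i * m + β i)).primeFactorsList.length ≤ 27 ∧
        ∀ i, Squarefree (α i * m + β i)) ∪
      ((Finset.range X).filter fun m => ∃ i, ∃ p : ℕ, p.Prime ∧ k < p ∧
        p ^ 2 ∣ α i * m + β i) := by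
    intro m hm
    rw [Finset.mem_filter] at hm
    obtain ⟨hm, hpos⟩ := hm
    rw [Finset.mem_union, Finset.mem_filter, Finset.mem_filter, or_iff_not_imp_right]
    intro hnot
    refine ⟨hm, ?_⟩
    have hdvd : ∀ p : ℕ, p.Prime → p ∣ ∏ i, (α i * m + β i) → D₀ < p := fun p hp h => by
      obtain ⟨i, -, hi⟩ := (hp.prime.dvd_finsetProd_iff _).1 h
      exact hαβD p hp i m hi
    have hsq : ∀ i, Squarefree (α i * m + β i) := fun i => by
      rw [Nat.squarefree_iff_prime_squarefree]
      intro p hp h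
      refine hnot ⟨hm, i, p, hp, ?_, by rwa [sq]⟩
      have h1 := lt_log_of_sieveMultiplier_pos hL hP hdvd hpos hp
        ((dvd_of_mul_left_dvd h).trans (Finset.dvd_prod_of_mem _ (Finset.mem_univ i)))
      rw [Real.lt_log_iff_exp_lt (by exact_mod_cast hp.pos), ← mul_assoc] at h1
      exact (Nat.floor_lt (Real.exp_pos _).le).2 h1
    refine ⟨?_, hsq⟩
    have hsqprod : Squarefree (∏ i, (α i * m + β i)) := by
      refine Finset.squarefree_prod_of_pairwise_isCoprime (fun i _ j _ hij => ?_) fun i _ => hsq i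
      rw [Function.onFun, ← Nat.coprime_iff_isRelPrime]
      exact Nat.coprime_of_dvd fun p hp hi hj => hαβ p hp i j hij m hi hj
    have h1 := length_primeFactorsList_lt_of_sieveMultiplier_pos hL hsqprod hP hdvd hpos
    have h2 : ∏ i, (α i * m + β i) ≤ (A * X) ^ 7 := by
      have h3 : ∏ i, (α i * m + β i) ≤ ∏ _i : Fin 7, A * X :=
        Finset.prod_le_prod' fun i _ => hAX i m (Finset.mem_range.1 hm)
      simpa using h3
    have h4 : Real.log (∏ i, (α i * m + β i) : ℕ) ≤ 7 * (Real.log A + l) := by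
      have h5 := Real.log_le_log (by exact_mod_cast Nat.pos_of_ne_zero hsqprod.ne_zero)
        (Nat.cast_le (α := ℝ).2 h2)
      rw [Nat.cast_pow, Real.log_pow, Nat.cast_mul, Real.log_mul (by positivity) hX0.ne'] at h5
      simpa using h5
    have h6 : Real.log (∏ i, (α i * m + β i) : ℕ) / (2 * (0.245 * l)) ≤ 14.4 := by
      rw [div_le_iff₀ (by positivity)]
      linarith
    have h7 : ((∏ i, (α i * m + β i)).primeFactorsList.length : ℝ) < (28 : ℕ) := by
      refine h1.trans_le ?_
      push_cast
      norm_num at h6 ⊢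
      linarith
    exact Nat.lt_succ_iff.1 (Nat.cast_lt.1 h7)
  have hle := (Nat.cast_le (α := ℝ)).2 ((Finset.card_le_card hsub).trans (Finset.card_union_le _ _))
  rw [Nat.cast_add] at hle
  have hsplit : κ * X / l ^ 7 = κ / 2 * X / l ^ 7 + κ / 2 * X / l ^ 7 := by ring
  have hbad' := hbad.trans hbad2
  linarith

theorem exists_forall_prime_modEq (D₀ B : ℕ) (r : ℕ → ℕ) :
    ∃ v : ℕ, B ≤ v ∧ ∀ p : ℕ, p.Prime → p ≤ D₀ → v ≡ r p [MOD p] := by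
  obtain ⟨v, hv⟩ := Nat.chineseRemainderOfFinset r id ((Finset.range (D₀ + 1)).filter Nat.Prime)
    (fun p hp => (Finset.mem_filter.1 hp).2.ne_zero)
    (fun p hp q hq hpq => (Nat.coprime_primes (Finset.mem_filter.1 (Finset.mem_coe.1 hp)).2
      (Finset.mem_filter.1 (Finset.mem_coe.1 hq)).2).2 hpq)
  refine ⟨v + D₀.factorial * B, ?_, fun p hp hpD => ?_⟩
  · exact (Nat.le_mul_of_pos_left B (Nat.factorial_pos D₀)).trans (Nat.le_add_left _ _)
  · have h1 : v ≡ r p [MOD p] :=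
      hv p (Finset.mem_filter.2 ⟨Finset.mem_range.2 (Nat.lt_succ_of_le hpD), hp⟩)
    have h2 : D₀.factorial * B ≡ 0 [MOD p] :=
      (Nat.modEq_zero_iff_dvd).2 (((Nat.Prime.dvd_factorial hp).2 hpD).mul_right B)
    exact h1.add h2

theorem exists_natCast_linear_forms (a b : Fin 7 → ℤ) (ha : ∀ i, 1 ≤ a i)
    (hnz : (∏ i, a i) *
        (∏ ts ∈ Finset.univ.filter (fun ts : Fin 7 × Fin 7 => ts.1 < ts.2),
          (a ts.1 * b ts.2 - a ts.2 * b ts.1)) ≠ 0)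
    (hnofixed : ∀ p : ℕ, p.Prime →
      ∃ n : ℕ, 0 < n ∧ ¬ (p : ℤ) ∣ ∏ i, (a i * n + b i)) :
    ∃ (W v D₀ : ℕ) (α β : Fin 7 → ℕ), 0 < W ∧ 0 < v ∧ 7 ^ 100 ≤ D₀ ∧ (∀ i, 0 < β i) ∧
      (∀ (i) (m : ℕ), a i * (W * m + v : ℕ) + b i = (α i * m + β i : ℕ)) ∧
      (∀ p : ℕ, p.Prime → ∀ i m, p ∣ α i * m + β i → D₀ < p) ∧
      (∀ p : ℕ, p.Prime → D₀ < p → ∀ i, ¬ p ∣ α i) ∧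
      (∀ p : ℕ, p.Prime → ∀ i j, i ≠ j → ∀ m, p ∣ α i * m + β i → ¬ p ∣ α j * m + β j) := by
  set T := (∏ i, a i) *
    (∏ ts ∈ Finset.univ.filter (fun ts : Fin 7 × Fin 7 => ts.1 < ts.2),
      (a ts.1 * b ts.2 - a ts.2 * b ts.1)) with hT
  set D₀ := 7 ^ 100 + T.natAbs with hD₀
  choose! r hr0 hr using hnofixed
  obtain ⟨v, hv, hvr⟩ := exists_forall_prime_modEq D₀ (∑ i, (b i).natAbs + 1) r
  have hbv : ∀ i, 0 < a i * v + b i := fun i => by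
    have h1 : (b i).natAbs ≤ ∑ i, (b i).natAbs :=
      Finset.single_le_sum (f := fun i => (b i).natAbs) (fun _ _ => Nat.zero_le _)
        (Finset.mem_univ i)
    have h2 : (v : ℤ) ≤ a i * v := le_mul_of_one_le_left (Nat.cast_nonneg v) (ha i)
    omega
  have hT_dvd : ∀ p : ℕ, D₀ < p → ¬ (p : ℤ) ∣ T := fun p hp h => by
    have := Nat.le_of_dvd (Int.natAbs_pos.2 hnz) (Int.natCast_dvd.1 h)
    omega
  have hα : ∀ i, ((a i * D₀.factorial).toNat : ℤ) = a i * D₀.factorial := fun i =>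
    Int.toNat_of_nonneg (mul_nonneg (by linarith [ha i]) (Nat.cast_nonneg _))
  have hβ : ∀ i, ((a i * v + b i).toNat : ℤ) = a i * v + b i := fun i =>
    Int.toNat_of_nonneg (hbv i).le
  have heq : ∀ (i) (m : ℕ), a i * (D₀.factorial * m + v : ℕ) + b i =
      ((a i * D₀.factorial).toNat * m + (a i * v + b i).toNat : ℕ) := fun i m => by
    rw [Nat.cast_add, Nat.cast_add, Nat.cast_mul, Nat.cast_mul, hα, hβ]
    ring
  have hbig : ∀ p : ℕ, p.Prime → ∀ i m,
      p ∣ (a i * D₀.factorial).toNat * m + (a i * v + b i).toNat → D₀ < p := by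
    intro p hp i m h
    by_contra! hpD
    rw [← Int.natCast_dvd_natCast, ← heq] at h
    have h1 : D₀.factorial * m + v ≡ 0 + r p [MOD p] :=
      ((Nat.modEq_zero_iff_dvd).2 (((Nat.Prime.dvd_factorial hp).2 hpD).mul_right m)).add
        (hvr p hp hpD)
    rw [zero_add] at h1
    have h2 := (Nat.modEq_iff_dvd.1 h1).mul_left (a i)
    have h3 := dvd_add h h2
    refine hr p hp (Dvd.dvd.trans ?_ (Finset.dvd_prod_of_mem _ (Finset.mem_univ i)))
    convert h3 using 1
    ring
  refine ⟨D₀.factorial, v, D₀, fun i => (a i * D₀.factorial).toNat,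
    fun i => (a i * v + b i).toNat, Nat.factorial_pos _, by omega, Nat.le_add_right _ _, fun i => ?_,
    heq, hbig, ?_, ?_⟩
  · exact Int.lt_toNat.2 (hbv i)
  · intro p hp hpD i h
    rw [← Int.natCast_dvd_natCast, hα] at h
    rcases (Nat.prime_iff_prime_int.1 hp).dvd_or_dvd h with h | h
    · exact hT_dvd p hpD
        ((h.trans (Finset.dvd_prod_of_mem a (Finset.mem_univ i))).mul_right _)
    · exact absurd ((Nat.Prime.dvd_factorial hp).1 (Int.natCast_dvd_natCast.1 h)) (not_le.2 hpD)
  · intro p hp i j hij m hi hj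
    have hpD := hbig p hp i m hi
    rw [← Int.natCast_dvd_natCast, ← heq] at hi hj
    have h1 : (p : ℤ) ∣ a i * b j - a j * b i := by
      have h2 := dvd_sub (hj.mul_left (a i)) (hi.mul_left (a j))
      have e : a i * (a j * (D₀.factorial * m + v : ℕ) + b j) -
          a j * (a i * (D₀.factorial * m + v : ℕ) + b i) = a i * b j - a j * b i := by ring
      rwa [e] at h2
    have h3 : ∀ s t : Fin 7, s < t → ¬ (p : ℤ) ∣ a s * b t - a t * b s := fun s t hst h =>
      hT_dvd p hpD ((h.trans (Finset.dvd_prod_of_mem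
        (fun ts : Fin 7 × Fin 7 => a ts.1 * b ts.2 - a ts.2 * b ts.1) (a := (s, t))
        (Finset.mem_filter.2 ⟨Finset.mem_univ _, hst⟩))).mul_left _)
    rcases lt_or_gt_of_ne hij with h | h
    · exact h3 i j h h1
    · refine h3 j i h ?_
      rw [← neg_sub]
      exact h1.neg_right

open Classical in
theorem seven_dim_sieve_squarefree
    (a b : Fin 7 → ℤ) (ha : ∀ i, 1 ≤ a i)
    (hnz : (∏ i, a i) *
        (∏ ts ∈ Finset.univ.filter (fun ts : Fin 7 × Fin 7 => ts.1 < ts.2),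
          (a ts.1 * b ts.2 - a ts.2 * b ts.1)) ≠ 0)
    (hnofixed : ∀ p : ℕ, p.Prime →
      ∃ n : ℕ, 0 < n ∧ ¬ (p : ℤ) ∣ ∏ i, (a i * n + b i)) :
    ∃ δ : ℝ, 0 < δ ∧ ∃ x₀ : ℝ, ∀ x : ℝ, x₀ ≤ x →
      δ * x / (Real.log x) ^ 7 ≤
        (((Finset.Icc 1 ⌊x⌋₊).filter fun n : ℕ =>
            0 < ∏ i, (a i * n + b i) ∧
            (∏ i, (a i * n + b i)).natAbs.primeFactorsList.length ≤ 27 ∧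
            ∀ i, Squarefree (a i * n + b i)).card : ℝ) := by
  obtain ⟨W, v, D₀, α, β, hW, hv, hD₀, hβ, heq, h1, h2, h3⟩ :=
    exists_natCast_linear_forms a b ha hnz hnofixed
  obtain ⟨δ, hδ, hmain⟩ := exists_eventually_le_card_filter_squarefree (A := ∑ i, (α i + β i)) hβ
    (fun i => Finset.single_le_sum (f := fun i => α i + β i) (fun _ _ => Nat.zero_le _)
      (Finset.mem_univ i)) hD₀ h1 h2 h3
  have hW0 : (0 : ℝ) < W := by exact_mod_cast hW
  refine ⟨δ / (2 * W), by positivity, Filter.eventually_atTop.1 ?_⟩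
  have htend : Filter.Tendsto (fun x : ℝ => ⌊(x - v) / W⌋₊) Filter.atTop Filter.atTop :=
    tendsto_nat_floor_atTop.comp
      ((Filter.tendsto_atTop_add_const_right _ (-(v : ℝ)) Filter.tendsto_id).atTop_div_const hW0)
  filter_upwards [htend.eventually hmain, htend.eventually_ge_atTop 2,
    Filter.eventually_ge_atTop (2 * (v + W : ℝ))] with x hx hX2 hx0
  set X := ⌊(x - v) / W⌋₊ with hX
  have hx1 : 0 ≤ (x - v) / W := div_nonneg (by linarith) hW0.le
  have hXW : W * X + v ≤ x := by
    have h := (le_div_iff₀ hW0).1 (Nat.floor_le hx1)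
    rw [← hX] at h
    linarith
  have hxX : x / (2 * W) ≤ X := by
    have h := (div_lt_iff₀ hW0).1 (Nat.lt_floor_add_one ((x - v) / W))
    rw [← hX] at h
    rw [div_le_iff₀ (by positivity)]
    linarith
  have hX2' : (2 : ℝ) ≤ X := by exact_mod_cast hX2
  have hlogX : 0 < Real.log X := Real.log_pos (by linarith)
  have hXx : (X : ℝ) ≤ x := by
    have hW1 : (1 : ℝ) ≤ W := by exact_mod_cast hW
    have hv0 : (0 : ℝ) ≤ v := Nat.cast_nonneg v
    nlinarith
  have hlog : Real.log X ≤ Real.log x := Real.log_le_log (by linarith) hXx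
  have h4 : δ / (2 * W) * x / Real.log x ^ 7 ≤ δ * X / Real.log X ^ 7 := by
    have h5 : δ / (2 * W) * x ≤ δ * X := by
      rw [div_mul_eq_mul_div, mul_div_assoc]
      exact mul_le_mul_of_nonneg_left hxX hδ.le
    gcongr
  refine h4.trans (hx.trans (Nat.cast_le.2 ?_))
  refine Finset.card_le_card_of_injOn (fun m => W * m + v) (fun m hm => ?_)
    (fun m _ n _ h => Nat.eq_of_mul_eq_mul_left hW (Nat.add_right_cancel h))
  rw [Finset.mem_coe, Finset.mem_filter, Finset.mem_range] at hm
  obtain ⟨hm, hlen, hsq⟩ := hm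
  have hprod : ∏ i, (a i * (W * m + v : ℕ) + b i) = (∏ i, (α i * m + β i) : ℕ) := by
    rw [Nat.cast_prod]
    exact Finset.prod_congr rfl fun i _ => heq i m
  rw [Finset.mem_coe, Finset.mem_filter, Finset.mem_Icc]
  refine ⟨⟨Nat.le_add_left_of_le hv, Nat.le_floor ?_⟩, ?_, ?_, fun i => ?_⟩
  · refine le_trans ?_ hXW
    push_cast
    gcongr
  · rw [hprod]
    exact_mod_cast Finset.prod_pos fun i _ => Nat.add_pos_right _ (hβ i)
  · rwa [hprod, Int.natAbs_natCast]
  · rw [heq, Int.squarefree_natCast]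
    exact hsq i
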